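/- arXiv:0811.3169 — 9 statements merged into one kernel-verified Lean document; each statement's English description precedes it below -/
import Mathlib

section
/- Let e ≥ 1 be an integer and let r be a real number with 0 < r < 1. Then the set {z ∈ K : ‖z^(p^e) − 1‖ ≤ r} can be written as a union of p^e pairwise disjoint closed balls, each of which is mapped bijectively onto the closed ball B̄(1, r) by the map z ↦ z^(p^e), if and only if r < p^(−e − 1/(p−1)). (This is the ball-theoretic content of the statement that the covering z ↦ z^(p^e) of G_m is split over the point B(1,r) exactly when r < p^(−e−1/(p−1)).) -/
theorem norm_eq_one_of_pow_eq_one_of_ne_zero {K : Type*} [NormedField K] {n : ℕ} {ζ : K}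
    (h : ζ ^ n = 1) (hn : n ≠ 0) : ‖ζ‖ = 1 :=
  (isOfFinOrder_iff_pow_eq_one.2 ⟨n, Nat.pos_of_ne_zero hn, h⟩).norm_eq_one

section PowerMap

variable {K : Type*} [NormedField K] [IsUltrametricDist K] {p : ℕ} {lam : ℝ}

/-- The middle terms of the binomial expansion of `(1 + w) ^ p`, beyond the linear one, are
bounded by `‖p‖ * ‖w‖ ^ 2`. -/
theorem norm_one_add_pow_prime_sub_le (hp : p.Prime) {w : K} (hw : ‖w‖ ≤ 1) :
    ‖(1 + w) ^ p - 1 - w ^ p - p * w‖ ≤ ‖(p : K)‖ * ‖w‖ ^ 2 := by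
  obtain ⟨m, rfl⟩ : ∃ m, p = m + 2 := ⟨p - 2, by have := hp.two_le; omega⟩
  have key : (1 + w) ^ (m + 2) - 1 - w ^ (m + 2) - ((m + 2 : ℕ) : K) * w
      = ∑ k ∈ Finset.range m, w ^ (k + 2) * ((m + 2).choose (k + 2) : K) := by
    rw [add_comm 1 w, add_pow, Finset.sum_range_succ, Finset.sum_range_succ',
      Finset.sum_range_succ']
    simp
    ring
  rw [key]
  refine IsUltrametricDist.norm_sum_le_of_forall_le_of_nonneg (by positivity) fun k hk ↦ ?_
  obtain ⟨c, hc⟩ := hp.dvd_choose_self (k := k + 2) (by omega)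
    (by have := Finset.mem_range.1 hk; omega)
  rw [hc, Nat.cast_mul, norm_mul, norm_mul, norm_pow, mul_comm]
  refine mul_le_mul ?_ (pow_le_pow_of_le_one (norm_nonneg _) hw (by omega)) (by positivity)
    (norm_nonneg _)
  exact mul_le_of_le_one_right (norm_nonneg _) (IsUltrametricDist.norm_natCast_le_one K c)

theorem norm_pow_prime_sub_one_of_lt (hp : p.Prime) (hpK : ‖(p : K)‖ = (p : ℝ)⁻¹)
    (hlam1 : lam < 1) (hlam : lam ^ (p - 1) = (p : ℝ)⁻¹) {z : K} (hz : ‖z - 1‖ < lam) :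
    ‖z ^ p - 1‖ = ‖z - 1‖ / p := by
  obtain ⟨w, rfl⟩ : ∃ w, z = 1 + w := ⟨z - 1, by ring⟩
  rw [add_sub_cancel_left] at hz ⊢
  rcases eq_or_ne w 0 with rfl | hw
  · simp
  have hw0 : 0 < ‖w‖ := norm_pos_iff.2 hw
  have hp0 : (0 : ℝ) < (p : ℝ)⁻¹ := inv_pos.2 (by exact_mod_cast hp.pos)
  have hw1 : ‖w‖ < 1 := hz.trans hlam1
  have hlin : ‖(p : K) * w‖ = ‖w‖ / p := by rw [norm_mul, hpK]; ring
  have hmid : ‖(1 + w) ^ p - 1 - w ^ p - p * w‖ < ‖(p : K) * w‖ := by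
    refine (norm_one_add_pow_prime_sub_le hp hw1.le).trans_lt ?_
    rw [norm_mul, hpK]
    gcongr
    nlinarith
  have htop : ‖w ^ p‖ < ‖(p : K) * w‖ := by
    obtain ⟨m, rfl⟩ : ∃ m, p = m + 1 := ⟨p - 1, by have := hp.pos; omega⟩
    rw [norm_pow, pow_succ, norm_mul, hpK, ← hlam]
    have hm : m ≠ 0 := by have := hp.two_le; omega
    gcongr
    exact pow_lt_pow_left₀ hz (norm_nonneg _) hm
  have hrest : ‖((1 + w) ^ p - 1 - w ^ p - p * w) + w ^ p‖ < ‖(p : K) * w‖ :=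
    (IsUltrametricDist.norm_add_le_max _ _).trans_lt (max_lt hmid htop)
  rw [← hlin, ← IsUltrametricDist.norm_add_eq_max_of_norm_ne_norm hrest.ne |>.trans
    (max_eq_right hrest.le)]
  congr 1
  ring

theorem norm_pow_prime_pow_sub_one_of_lt (hp : p.Prime) (hpK : ‖(p : K)‖ = (p : ℝ)⁻¹)
    (hlam1 : lam < 1) (hlam : lam ^ (p - 1) = (p : ℝ)⁻¹) {z : K} (hz : ‖z - 1‖ < lam) (e : ℕ) :
    ‖z ^ p ^ e - 1‖ = ‖z - 1‖ / (p : ℝ) ^ e := by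
  induction e with
  | zero => simp
  | succ e ih =>
    have hp1 : (1 : ℝ) ≤ (p : ℝ) ^ e := one_le_pow₀ (by exact_mod_cast hp.one_le)
    rw [pow_succ, pow_mul, norm_pow_prime_sub_one_of_lt hp hpK hlam1 hlam, ih, div_div, pow_succ]
    rw [ih]
    exact (div_le_self (norm_nonneg _) hp1).trans_lt hz


theorem le_norm_sub_one_of_pow_eq_one (hp : p.Prime) (hpK : ‖(p : K)‖ = (p : ℝ)⁻¹)
    (hlam1 : lam < 1) (hlam : lam ^ (p - 1) = (p : ℝ)⁻¹) {e : ℕ} {ζ : K}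
    (hζ : ζ ^ p ^ e = 1) (hζ1 : ζ ≠ 1) : lam ≤ ‖ζ - 1‖ := by
  by_contra! h
  have := norm_pow_prime_pow_sub_one_of_lt hp hpK hlam1 hlam h e
  have hp0 : (p : ℝ) ^ e ≠ 0 := pow_ne_zero _ (by exact_mod_cast hp.ne_zero)
  rw [hζ, sub_self, norm_zero, eq_comm, div_eq_zero_iff, norm_eq_zero, sub_eq_zero] at this
  tauto

theorem norm_sub_one_le_of_pow_prime_eq_one (hp : p.Prime) (hpK : ‖(p : K)‖ = (p : ℝ)⁻¹)
    (hlam0 : 0 < lam) (hlam : lam ^ (p - 1) = (p : ℝ)⁻¹) {ζ : K} (hζ : ζ ^ p = 1) :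
    ‖ζ - 1‖ ≤ lam := by
  by_contra! h
  obtain ⟨w, rfl⟩ : ∃ w, ζ = 1 + w := ⟨ζ - 1, by ring⟩
  rw [add_sub_cancel_left] at h
  have hw0 : 0 < ‖w‖ := hlam0.trans h
  have hw1 : ‖w‖ ≤ 1 := by
    have h1 := norm_eq_one_of_pow_eq_one_of_ne_zero hζ hp.ne_zero
    have := IsUltrametricDist.norm_add_le_max (1 + w) (-1)
    simpa [h1] using this
  have hmid := norm_one_add_pow_prime_sub_le hp hw1
  have hlin : ‖(p : K) * w‖ = (p : ℝ)⁻¹ * ‖w‖ := by rw [norm_mul, hpK]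
  have hp0 : (0 : ℝ) < (p : ℝ)⁻¹ := inv_pos.2 (by exact_mod_cast hp.pos)
  have hmid' : ‖(1 + w) ^ p - 1 - w ^ p - p * w‖ ≤ (p : ℝ)⁻¹ * ‖w‖ := by
    refine hmid.trans ?_
    rw [hpK]
    gcongr
    nlinarith
  have htop : ‖w ^ p‖ ≤ (p : ℝ)⁻¹ * ‖w‖ := by
    rw [← norm_neg, show -w ^ p = ((1 + w) ^ p - 1 - w ^ p - p * w) + p * w by rw [hζ]; ring]
    exact (IsUltrametricDist.norm_add_le_max _ _).trans (max_le hmid' hlin.le)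
  have hlt : (p : ℝ)⁻¹ * ‖w‖ < ‖w ^ p‖ := by
    obtain ⟨m, rfl⟩ : ∃ m, p = m + 1 := ⟨p - 1, by have := hp.pos; omega⟩
    rw [norm_pow, pow_succ, ← hlam]
    have hm : m ≠ 0 := by have := hp.two_le; omega
    gcongr
    exact pow_lt_pow_left₀ h hlam0.le hm
  exact hlt.not_ge htop

theorem exists_pow_eq_one_norm_sub_lt [IsAlgClosed K] (hp : p.Prime)
    (hpK : ‖(p : K)‖ = (p : ℝ)⁻¹) (hlam0 : 0 < lam)
    (hlam1 : lam < 1) (hlam : lam ^ (p - 1) = (p : ℝ)⁻¹) (e : ℕ) {z : K}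
    (hz : ‖z ^ p ^ e - 1‖ < lam / (p : ℝ) ^ e) : ∃ ζ : K, ζ ^ p ^ e = 1 ∧ ‖z - ζ‖ < lam := by
  have hp0 : (0 : ℝ) < p := by exact_mod_cast hp.pos
  have hpK0 : (p : K) ≠ 0 := norm_pos_iff.1 (by rw [hpK]; positivity)
  have : NeZero (p : K) := ⟨hpK0⟩
  have hlamp : lam ^ p = lam / p := by
    rw [← Nat.sub_add_cancel hp.one_le, pow_succ, hlam, Nat.sub_add_cancel hp.one_le]
    ring
  induction e generalizing z with
  | zero => exact ⟨1, by simp, by simpa using hz⟩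
  | succ e ih =>
    rw [pow_succ, pow_mul] at hz
    set y := z ^ p ^ e with hy
    obtain ⟨ε, hε⟩ := HasEnoughRootsOfUnity.exists_primitiveRoot K p
    obtain ⟨ζ, hζ, hyζ⟩ : ∃ ζ : K, ζ ^ p = 1 ∧ ‖y - ζ‖ < lam := by
      by_contra! hcon
      have hprod : y ^ p - 1 = ∏ ζ ∈ Polynomial.nthRootsFinset p (1 : K), (y - ζ) := by
        have := congrArg (Polynomial.eval y) (Polynomial.X_pow_sub_one_eq_prod hp.pos hε)
        simpa [Polynomial.eval_prod] using this
      have hle : lam ^ p ≤ ‖y ^ p - 1‖ := by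
        rw [hprod, norm_prod]
        calc lam ^ p = ∏ ζ ∈ Polynomial.nthRootsFinset p (1 : K), lam := by
              rw [Finset.prod_const, hε.card_nthRootsFinset]
          _ ≤ _ := Finset.prod_le_prod (fun _ _ ↦ hlam0.le) fun ζ hζ ↦
              hcon ζ ((Polynomial.mem_nthRootsFinset hp.pos _).1 hζ)
      have : lam / (p : ℝ) ^ (e + 1) ≤ lam / p := by
        gcongr
        exact le_self_pow₀ (by exact_mod_cast hp.one_le) (by omega)
      exact absurd (hz.trans_le this) (not_lt.2 (hlamp ▸ hle))
    have hζ1 := norm_eq_one_of_pow_eq_one_of_ne_zero hζ hp.ne_zero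
    have hζ0 : ζ ≠ 0 := norm_pos_iff.1 (by simp [hζ1])
    obtain ⟨ξ, hξ⟩ := IsAlgClosed.exists_pow_nat_eq ζ (pow_pos hp.pos e)
    have hξq : ξ ^ p ^ (e + 1) = 1 := by rw [pow_succ, pow_mul, hξ, hζ]
    have hξ1 := norm_eq_one_of_pow_eq_one_of_ne_zero hξq (pow_pos hp.pos _).ne'
    have hξ0 : ξ ≠ 0 := norm_pos_iff.1 (by simp [hξ1])
    have hdiv : ‖y / ζ - 1‖ < lam := by
      rwa [div_sub_one hζ0, norm_div, hζ1, div_one]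
    have hA := norm_pow_prime_sub_one_of_lt hp hpK hlam1 hlam hdiv
    rw [div_pow, hζ, div_one] at hA
    obtain ⟨η, hη, hzη⟩ := ih (z := z / ξ) (by
      rw [div_pow, hξ, ← hy]
      rw [hA, pow_succ, ← div_div] at hz
      exact (div_lt_div_iff_of_pos_right hp0).1 hz)
    refine ⟨ξ * η, ?_, ?_⟩
    · rw [mul_pow, hξq, pow_succ, pow_mul, hη, one_pow, one_mul]
    · have : z - ξ * η = ξ * (z / ξ - η) := by field_simp
      rwa [this, norm_mul, hξ1, one_mul]

end PowerMap


/-- Let `K` be an algebraically closed field, complete with respect to a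
multiplicative nonarchimedean absolute value (norm) with `‖p‖ = p⁻¹`. For an integer `e ≥ 1`
and a real `0 < r < 1`, the set `{z : ‖z^(p^e) - 1‖ ≤ r}` is a union of `p^e` pairwise
disjoint closed balls, each mapped bijectively onto the closed ball `B̄(1, r)` by
`z ↦ z^(p^e)`, if and only if `r < p^(-e - 1/(p-1))`. -/
theorem splitting_of_pe_power_map_iff
    {K : Type*} [NormedField K] [IsAlgClosed K] [CompleteSpace K] [IsUltrametricDist K]
    (p : ℕ) (hp : p.Prime) (hpK : ‖(p : K)‖ = (p : ℝ)⁻¹)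
    (e : ℕ) (he : 1 ≤ e) (r : ℝ) (hr0 : 0 < r) (hr1 : r < 1) :
    (∃ (c : Fin (p ^ e) → K) (ρ : Fin (p ^ e) → ℝ),
      (Pairwise fun i j =>
        Disjoint (Metric.closedBall (c i) (ρ i)) (Metric.closedBall (c j) (ρ j))) ∧
      ({z : K | ‖z ^ (p ^ e) - 1‖ ≤ r} = ⋃ i, Metric.closedBall (c i) (ρ i)) ∧
      (∀ i, Set.BijOn (fun z : K => z ^ (p ^ e)) (Metric.closedBall (c i) (ρ i))
        (Metric.closedBall (1 : K) r)))
    ↔ r < (p : ℝ) ^ (-(e : ℝ) - 1 / ((p : ℝ) - 1)) := by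
  have hp0 : (0 : ℝ) < p := by exact_mod_cast hp.pos
  have hp1 : (1 : ℝ) < p := by exact_mod_cast hp.one_lt
  have hpK0 : (p : K) ≠ 0 := norm_pos_iff.1 (by rw [hpK]; positivity)
  have hpe : (0 : ℝ) < (p : ℝ) ^ e := by positivity
  have hq : p ^ e ≠ 0 := (pow_pos hp.pos e).ne'
  have : NeZero (p ^ e) := ⟨hq⟩
  obtain ⟨lam, hlamdef⟩ : ∃ lam : ℝ, lam = (p : ℝ) ^ (-(1 / ((p : ℝ) - 1))) := ⟨_, rfl⟩
  have hlam0 : 0 < lam := hlamdef ▸ Real.rpow_pos_of_pos hp0 _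
  have hlam1 : lam < 1 := by
    rw [hlamdef]
    refine Real.rpow_lt_one_of_one_lt_of_neg hp1 ?_
    have : 0 < 1 / ((p : ℝ) - 1) := one_div_pos.2 (by linarith)
    linarith
  have hlam : lam ^ (p - 1) = (p : ℝ)⁻¹ := by
    rw [hlamdef, ← Real.rpow_natCast, ← Real.rpow_mul hp0.le, Nat.cast_sub hp.one_le,
      Nat.cast_one, neg_mul, one_div_mul_cancel (by linarith), Real.rpow_neg_one]
  have hbound : (p : ℝ) ^ (-(e : ℝ) - 1 / ((p : ℝ) - 1)) = lam / (p : ℝ) ^ e := by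
    rw [sub_eq_add_neg, Real.rpow_add hp0, Real.rpow_neg hp0.le, Real.rpow_natCast, hlamdef]
    ring
  rw [hbound]
  constructor
  · rintro ⟨c, ρ, -, hU, hbij⟩
    by_contra! hr
    have : NeZero (p : K) := ⟨hpK0⟩
    obtain ⟨ζ, hζ⟩ := HasEnoughRootsOfUnity.exists_primitiveRoot K p
    have hζe : ζ ^ p ^ e = 1 := by
      obtain ⟨m, rfl⟩ : ∃ m, e = m + 1 := ⟨e - 1, by omega⟩
      rw [pow_succ', pow_mul, hζ.pow_eq_one, one_pow]
    have hζ1 : ζ ≠ 1 := hζ.ne_one hp.one_lt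
    have hζn : ‖ζ - 1‖ = lam :=
      le_antisymm (norm_sub_one_le_of_pow_prime_eq_one hp hpK hlam0 hlam hζ.pow_eq_one)
        (le_norm_sub_one_of_pow_eq_one hp hpK hlam1 hlam hζe hζ1)
    have h1 : (1 : K) ∈ ⋃ i, Metric.closedBall (c i) (ρ i) := by
      rw [← hU]
      simpa using hr0.le
    obtain ⟨i, hi⟩ := Set.mem_iUnion.1 h1
    have hb := hbij i
    rw [IsUltrametricDist.closedBall_eq_of_mem hi] at hb
    have hρ0 : 0 ≤ ρ i := dist_nonneg.trans (Metric.mem_closedBall.1 hi)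
    have hρ : ρ i < lam := by
      by_contra! h
      refine hζ1 (hb.injOn ?_ (Metric.mem_closedBall_self hρ0) ?_)
      · rwa [mem_closedBall_iff_norm, hζn]
      · simp [hζe]
    have hx : ‖(1 + (p : K) ^ e * (ζ - 1)) - 1‖ = lam / (p : ℝ) ^ e := by
      rw [add_sub_cancel_left, norm_mul, hζn, norm_pow, hpK, inv_pow]
      ring
    obtain ⟨z, hz, hzx⟩ := hb.surjOn (mem_closedBall_iff_norm.2 (hx.trans_le hr))
    have hz' := mem_closedBall_iff_norm.1 hz
    have hzn := norm_pow_prime_pow_sub_one_of_lt hp hpK hlam1 hlam (hz'.trans_lt hρ) e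
    have hzx' : z ^ p ^ e = 1 + (p : K) ^ e * (ζ - 1) := hzx
    rw [hzx', hx, div_left_inj' hpe.ne'] at hzn
    linarith
  · intro hr
    have : NeZero (((p ^ e : ℕ) : K)) := ⟨by exact_mod_cast pow_ne_zero e hpK0⟩
    obtain ⟨ζ, hζ⟩ := HasEnoughRootsOfUnity.exists_primitiveRoot K (p ^ e)
    have hs : r * (p : ℝ) ^ e < lam := (lt_div_iff₀ hpe).1 hr
    have hs0 : 0 ≤ r * (p : ℝ) ^ e := by positivity
    have hroot (i : ℕ) : (ζ ^ i) ^ p ^ e = 1 := by rw [pow_right_comm, hζ.pow_eq_one, one_pow]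
    have hscale {x y : K} (hy : ‖y‖ = 1) (hxy : ‖x - y‖ ≤ r * (p : ℝ) ^ e) :
        ‖x ^ p ^ e - y ^ p ^ e‖ = ‖x - y‖ / (p : ℝ) ^ e := by
      have hy0 : y ≠ 0 := norm_pos_iff.1 (by simp [hy])
      have h1 : ‖x / y - 1‖ = ‖x - y‖ := by rw [div_sub_one hy0, norm_div, hy, div_one]
      have := norm_pow_prime_pow_sub_one_of_lt hp hpK hlam1 hlam
        (h1.trans_le hxy |>.trans_lt hs) e
      rwa [h1, div_pow, div_sub_one (pow_ne_zero _ hy0), norm_div, norm_pow, hy, one_pow,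
        div_one] at this
    have hcover {z : K} (hz : ‖z ^ p ^ e - 1‖ ≤ r) :
        ∃ ξ : K, ξ ^ p ^ e = 1 ∧ ‖z - ξ‖ ≤ r * (p : ℝ) ^ e := by
      obtain ⟨ξ, hξ, hzξ⟩ :=
        exists_pow_eq_one_norm_sub_lt hp hpK hlam0 hlam1 hlam e (hz.trans_lt hr)
      have hξ1 := norm_eq_one_of_pow_eq_one_of_ne_zero hξ hq
      have hξ0 : ξ ≠ 0 := norm_pos_iff.1 (by simp [hξ1])
      have h1 : ‖z / ξ - 1‖ = ‖z - ξ‖ := by rw [div_sub_one hξ0, norm_div, hξ1, div_one]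
      have := norm_pow_prime_pow_sub_one_of_lt hp hpK hlam1 hlam (h1.trans_lt hzξ) e
      rw [h1, div_pow, hξ, div_one] at this
      exact ⟨ξ, hξ, (div_le_iff₀ hpe).1 (this ▸ hz)⟩
    refine ⟨fun i ↦ ζ ^ (i : ℕ), fun _ ↦ r * (p : ℝ) ^ e, fun i j hij ↦ ?_, ?_, fun i ↦ ?_⟩
    · refine Set.disjoint_left.2 fun z hzi hzj ↦ hij (Fin.ext (hζ.pow_inj i.2 j.2 ?_))
      by_contra hne
      rw [mem_closedBall_iff_norm'] at hzi
      rw [mem_closedBall_iff_norm] at hzj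
      have hle : ‖ζ ^ (i : ℕ) - ζ ^ (j : ℕ)‖ ≤ r * (p : ℝ) ^ e := by
        rw [← sub_add_sub_cancel _ z]
        exact (IsUltrametricDist.norm_add_le_max _ _).trans (max_le hzi hzj)
      have := hscale (norm_eq_one_of_pow_eq_one_of_ne_zero (hroot j) hq) hle
      rw [hroot, hroot, sub_self, norm_zero, eq_comm, div_eq_zero_iff, norm_eq_zero,
        sub_eq_zero] at this
      exact this.elim hne hpe.ne'
    · ext z
      simp only [Set.mem_ofPred_eq, Set.mem_iUnion, mem_closedBall_iff_norm]
      constructor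
      · intro hz
        obtain ⟨ξ, hξ, hzξ⟩ := hcover hz
        obtain ⟨i, hi, rfl⟩ := hζ.eq_pow_of_pow_eq_one hξ
        exact ⟨⟨i, hi⟩, hzξ⟩
      · rintro ⟨i, hi⟩
        have := hscale (norm_eq_one_of_pow_eq_one_of_ne_zero (hroot i) hq) hi
        rw [hroot] at this
        rw [this]
        exact (div_le_iff₀ hpe).2 hi
    · have hi1 := norm_eq_one_of_pow_eq_one_of_ne_zero (hroot i) hq
      refine ⟨fun z hz ↦ ?_, fun x hx y hy hxy ↦ ?_, fun y hy ↦ ?_⟩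
      · rw [mem_closedBall_iff_norm] at hz ⊢
        have := hscale hi1 hz
        rw [hroot] at this
        rw [this]
        exact (div_le_iff₀ hpe).2 hz
      · have hxy' : x ^ p ^ e = y ^ p ^ e := hxy
        have hle : ‖x - y‖ ≤ r * (p : ℝ) ^ e := by
          rw [mem_closedBall_iff_norm] at hx
          rw [mem_closedBall_iff_norm'] at hy
          rw [← sub_add_sub_cancel _ (ζ ^ (i : ℕ))]
          exact (IsUltrametricDist.norm_add_le_max _ _).trans (max_le hx hy)
        have hy1 : ‖y‖ = 1 := by
          rw [mem_closedBall_iff_norm] at hy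
          have hlt : ‖y - ζ ^ (i : ℕ)‖ < ‖ζ ^ (i : ℕ)‖ := by
            rw [hi1]
            linarith
          rw [← hi1, ← max_eq_right hlt.le,
            ← IsUltrametricDist.norm_add_eq_max_of_norm_ne_norm hlt.ne, sub_add_cancel]
        have := hscale hy1 hle
        rw [hxy', sub_self, norm_zero, eq_comm, div_eq_zero_iff, norm_eq_zero,
          sub_eq_zero] at this
        exact this.resolve_right hpe.ne'
      · obtain ⟨x, hx⟩ := IsAlgClosed.exists_pow_nat_eq y (pow_pos hp.pos e)
        rw [mem_closedBall_iff_norm, ← hx] at hy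
        obtain ⟨ξ, hξ, hxξ⟩ := hcover hy
        have hξ1 := norm_eq_one_of_pow_eq_one_of_ne_zero hξ hq
        have hξ0 : ξ ≠ 0 := norm_pos_iff.1 (by simp [hξ1])
        refine ⟨x / ξ * ζ ^ (i : ℕ), ?_, ?_⟩
        · rw [mem_closedBall_iff_norm, ← sub_one_mul, norm_mul, hi1, div_sub_one hξ0, norm_div,
            hξ1, mul_one, div_one]
          exact hxξ
        · change (x / ξ * ζ ^ (i : ℕ)) ^ p ^ e = y
          rw [mul_pow, hroot, div_pow, hξ, hx, div_one, mul_one]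
end

section
/- Let e ≥ 1 be an integer, let i be an integer with 0 ≤ i ≤ e − 1, and let r be a real number satisfying p^(−i − p/(p−1)) ≤ r, together with r < p^(−i − 1/(p−1)) if i ≥ 1, and r < 1 if i = 0. Then the set {z ∈ K : ‖z^(p^e) − 1‖ ≤ r} equals the union, over all ζ ∈ K with ζ^(p^e) = 1, of the closed balls B̄(ζ, (p^i·r)^(1/p^(e−i))); each of these balls contains exactly p^(e−i) of the p^e-th roots of unity of K; consequently the collection {B̄(ζ, (p^i·r)^(1/p^(e−i))) : ζ^(p^e) = 1} consists of exactly p^i distinct closed balls, and these p^i balls are pairwise disjoint. (This expresses that the point B(1,r) has exactly p^i preimages under z ↦ z^(p^e).) -/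
open Polynomial Finset in
theorem nthRootsFinset_mul_filter_pow_eq_one {R : Type*} [CommRing R] [IsDomain R]
    [DecidableEq R] {m d : ℕ} (hm : 0 < m) (hd : 0 < d) :
    {ν ∈ nthRootsFinset (m * d) (1 : R) | ν ^ m = 1} = nthRootsFinset m (1 : R) := by
  ext ν
  simp only [mem_filter, Polynomial.mem_nthRootsFinset (Nat.mul_pos hm hd),
    Polynomial.mem_nthRootsFinset hm]
  exact ⟨fun h ↦ h.2, fun h ↦ ⟨by rw [pow_mul, h, one_pow], h⟩⟩

open Polynomial Finset in
/-- The product of `1 - ν` over the `m * d`-th roots of unity `ν` that are not `m`-th roots of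
unity equals `d`. -/
theorem prod_one_sub_nthRoots_filter_pow_ne_one {R : Type*} [CommRing R] [IsDomain R]
    [DecidableEq R] {m d : ℕ} (hm : 0 < m) (hd : 0 < d) {ω : R} (hω : IsPrimitiveRoot ω (m * d)) :
    ∏ ν ∈ nthRootsFinset (m * d) (1 : R) with ν ^ m ≠ 1, (1 - ν) = d := by
  have hmd : 0 < m * d := Nat.mul_pos hm hd
  have hωd : IsPrimitiveRoot (ω ^ d) m := hω.pow hmd (mul_comm m d)
  have hprod : (X ^ m - 1) * ∏ ν ∈ nthRootsFinset (m * d) (1 : R) with ν ^ m ≠ 1, (X - C ν)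
      = (X ^ m - 1) * ∑ j ∈ range d, (X ^ m : R[X]) ^ j := by
    rw [mul_geom_sum, ← pow_mul, X_pow_sub_one_eq_prod hmd hω, X_pow_sub_one_eq_prod hm hωd,
      ← prod_filter_mul_prod_filter_not (nthRootsFinset (m * d) (1 : R)) (fun ν ↦ ν ^ m = 1),
      nthRootsFinset_mul_filter_pow_eq_one hm hd]
  have h := congrArg (eval 1) (mul_left_cancel₀ (X_pow_sub_C_ne_zero hm (1 : R)) hprod)
  simpa [eval_prod, eval_finsetSum] using h

namespace IsUltrametricDist

variable {K : Type*} [NormedField K]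

theorem norm_eq_one_of_pow_eq_one {x : K} {n : ℕ} (hn : n ≠ 0) (hx : x ^ n = 1) : ‖x‖ = 1 := by
  rw [← pow_eq_one_iff_of_nonneg (norm_nonneg x) hn, ← norm_pow, hx, norm_one]

open Polynomial Finset in
theorem norm_pow_sub_one_eq_prod [DecidableEq K] {m d : ℕ} (hm : 0 < m)
    (hd : 0 < d) {ω : K} (hω : IsPrimitiveRoot ω (m * d)) (w : K) :
    ‖w ^ (m * d) - 1‖ = (∏ ν ∈ nthRootsFinset m (1 : K), ‖w - ν‖) *
      ∏ ν ∈ nthRootsFinset (m * d) (1 : K) with ν ^ m ≠ 1, ‖w - ν‖ := by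
  have hmd : 0 < m * d := Nat.mul_pos hm hd
  have h := congrArg (fun f ↦ ‖eval w f‖) (X_pow_sub_one_eq_prod hmd hω)
  simp only [eval_sub, eval_pow, eval_X, eval_one, eval_prod, eval_C, norm_prod] at h
  rw [h, ← prod_filter_mul_prod_filter_not _ (fun ν ↦ ν ^ m = 1),
    nthRootsFinset_mul_filter_pow_eq_one hm hd]

open Polynomial Finset in
theorem ncard_roots_mem_closedBall {m d : ℕ} (hm : 0 < m) (hd : 0 < d) {ω : K}
    (hω : IsPrimitiveRoot ω (m * d)) {R : ℝ}
    (hroots : ∀ ν : K, ν ^ (m * d) = 1 → (‖ν - 1‖ ≤ R ↔ ν ^ m = 1))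
    {ζ : K} (hζ : ζ ^ (m * d) = 1) :
    {ξ : K | ξ ^ (m * d) = 1 ∧ ξ ∈ Metric.closedBall ζ R}.ncard = m := by
  have hmd : 0 < m * d := Nat.mul_pos hm hd
  have hζ0 : ζ ≠ 0 := by
    rintro rfl
    simp [hmd.ne'] at hζ
  have himage : {ξ : K | ξ ^ (m * d) = 1 ∧ ξ ∈ Metric.closedBall ζ R}
      = (ζ * ·) '' (nthRootsFinset m (1 : K) : Set K) := by
    ext ξ
    obtain ⟨ν, rfl⟩ : ∃ ν, ξ = ζ * ν := ⟨ζ⁻¹ * ξ, by field_simp⟩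
    have hnorm : ‖ζ * ν - ζ‖ = ‖ν - 1‖ := by
      rw [show ζ * ν - ζ = ζ * (ν - 1) by ring, norm_mul,
        norm_eq_one_of_pow_eq_one hmd.ne' hζ, one_mul]
    rw [(mul_right_injective₀ hζ0).mem_set_image]
    simp only [Set.mem_ofPred_eq, mul_pow, hζ, one_mul, Metric.mem_closedBall, dist_eq_norm, hnorm,
      mem_coe, Polynomial.mem_nthRootsFinset hm]
    refine ⟨fun h ↦ (hroots ν h.1).1 h.2, fun h ↦ ?_⟩
    have h' : ν ^ (m * d) = 1 := by rw [pow_mul, h, one_pow]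
    exact ⟨h', (hroots ν h').2 h⟩
  rw [himage, Set.ncard_image_of_injective _ (mul_right_injective₀ hζ0), Set.ncard_coe_finset,
    (hω.pow hmd (mul_comm m d)).card_nthRootsFinset]

variable [IsUltrametricDist K]

theorem norm_pow_sub_one_le {x : K} (hx : ‖x‖ ≤ 1) (a : ℕ) : ‖x ^ a - 1‖ ≤ ‖x - 1‖ := by
  induction a with
  | zero => simp
  | succ a ih =>
    have hsplit : x ^ (a + 1) - 1 = x * (x ^ a - 1) + (x - 1) := by ring
    rw [hsplit]
    refine (norm_add_le_max _ _).trans (max_le ?_ le_rfl)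
    rw [norm_mul]
    exact (mul_le_of_le_one_left (norm_nonneg _) hx).trans ih

theorem norm_sub_one_le_one {x : K} (hx : ‖x‖ ≤ 1) : ‖x - 1‖ ≤ 1 := by
  rw [sub_eq_add_neg]
  exact (norm_add_le_max _ _).trans (max_le hx (by simp))

/-- All primitive `n`-th roots of unity are at the same distance from `1`. -/
theorem norm_sub_one_eq_of_isPrimitiveRoot {n : ℕ} (hn : n ≠ 0) {ζ μ : K}
    (hζ : IsPrimitiveRoot ζ n) (hμ : IsPrimitiveRoot μ n) : ‖μ - 1‖ = ‖ζ - 1‖ := by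
  have key : ∀ {α β : K}, IsPrimitiveRoot α n → IsPrimitiveRoot β n → ‖β - 1‖ ≤ ‖α - 1‖ := by
    intro α β hα hβ
    have : NeZero n := ⟨hn⟩
    obtain ⟨a, -, rfl⟩ := hα.eq_pow_of_pow_eq_one hβ.pow_eq_one
    exact norm_pow_sub_one_le (norm_eq_one_of_pow_eq_one hn hα.pow_eq_one).le a
  exact le_antisymm (key hζ hμ) (key hμ hζ)

theorem norm_sub_one_pow_of_isPrimitiveRoot {p : ℕ} (hp : p.Prime) {k : ℕ} {ζ : K}
    (hζ : IsPrimitiveRoot ζ (p ^ (k + 1))) : ‖ζ - 1‖ ^ (p ^ k * (p - 1)) = ‖(p : K)‖ := by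
  have : Fact p.Prime := ⟨hp⟩
  have hn : p ^ (k + 1) ≠ 0 := pow_ne_zero _ hp.ne_zero
  rw [← Polynomial.eval_one_cyclotomic_prime_pow (R := K) k,
    Polynomial.cyclotomic_eq_prod_X_sub_primitiveRoots hζ, Polynomial.eval_prod, norm_prod,
    Finset.prod_congr rfl (g := fun _ ↦ ‖ζ - 1‖), Finset.prod_const, hζ.card_primitiveRoots,
    Nat.totient_prime_pow_succ hp]
  intro μ hμ
  rw [Polynomial.eval_sub, Polynomial.eval_X, Polynomial.eval_C, norm_sub_rev]
  exact norm_sub_one_eq_of_isPrimitiveRoot hn hζ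
    ((mem_primitiveRoots (Nat.pos_of_ne_zero hn)).1 hμ)

theorem norm_sub_one_pow_le_of_pow_eq_one {p : ℕ} (hp : p.Prime) {n : ℕ} {ν : K}
    (hν : ν ^ p ^ n = 1) : ‖ν - 1‖ ^ (p ^ n * (p - 1)) ≤ ‖(p : K)‖ ^ p := by
  obtain ⟨k, hkn, hk⟩ := (Nat.dvd_prime_pow hp).1 (orderOf_dvd_of_pow_eq_one hν)
  have hprim : IsPrimitiveRoot ν (p ^ k) := hk ▸ IsPrimitiveRoot.orderOf ν
  obtain _ | k := k
  · have h1 : ν = 1 := by simpa using hprim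
    have : p ^ n * (p - 1) ≠ 0 :=
      mul_ne_zero (pow_ne_zero _ hp.ne_zero) (Nat.sub_ne_zero_of_lt hp.one_lt)
    rw [h1, sub_self, norm_zero, zero_pow this]
    positivity
  · have hexp : p ^ n * (p - 1) = p ^ k * (p - 1) * p ^ (n - k) := by
      rw [mul_right_comm, ← pow_add, Nat.add_sub_cancel' (by omega)]
    rw [hexp, pow_mul, norm_sub_one_pow_of_isPrimitiveRoot hp hprim]
    exact pow_le_pow_of_le_one (norm_nonneg _) (norm_natCast_le_one K p)
      (Nat.le_self_pow (by omega) p)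

theorem le_norm_sub_one_pow_of_pow_ne_one {p : ℕ} (hp : p.Prime) {n e : ℕ} {ν : K}
    (hν : ν ^ p ^ e = 1) (hνn : ν ^ p ^ n ≠ 1) : ‖(p : K)‖ ≤ ‖ν - 1‖ ^ (p ^ n * (p - 1)) := by
  obtain ⟨k, hke, hk⟩ := (Nat.dvd_prime_pow hp).1 (orderOf_dvd_of_pow_eq_one hν)
  have hprim : IsPrimitiveRoot ν (p ^ k) := hk ▸ IsPrimitiveRoot.orderOf ν
  have hnk : n < k := by
    by_contra! h
    exact hνn ((hprim.pow_eq_one_iff_dvd _).2 (pow_dvd_pow p h))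
  obtain _ | k := k
  · omega
  · rw [← norm_sub_one_pow_of_isPrimitiveRoot hp hprim]
    have hν1 := norm_eq_one_of_pow_eq_one (pow_ne_zero e hp.ne_zero) hν
    exact pow_le_pow_of_le_one (norm_nonneg _) (norm_sub_one_le_one hν1.le)
      (Nat.mul_le_mul_right _ (Nat.pow_le_pow_right hp.pos (by omega)))

section Preimage

variable {m d : ℕ} {ω : K} {R : ℝ}

open Polynomial Finset

/-- If the `m`-th roots of unity are exactly the `m * d`-th roots of unity in `B̄(1, R)`, then
the preimage of `B̄(1, ‖d‖ * R ^ m)` under `z ↦ z ^ (m * d)` is the union of the balls of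
radius `R` centred at `m * d`-th roots of unity. -/
theorem norm_pow_sub_one_le_iff (hm : 0 < m) (hd : (d : K) ≠ 0)
    (hω : IsPrimitiveRoot ω (m * d)) (hR : 0 ≤ R)
    (hroots : ∀ ν : K, ν ^ (m * d) = 1 → (‖ν - 1‖ ≤ R ↔ ν ^ m = 1)) (z : K) :
    ‖z ^ (m * d) - 1‖ ≤ ‖(d : K)‖ * R ^ m ↔ ∃ ζ : K, ζ ^ (m * d) = 1 ∧ ‖z - ζ‖ ≤ R := by
  classical
  have hd0 : 0 < d := Nat.pos_of_ne_zero (by rintro rfl; simp at hd)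
  have hmd : 0 < m * d := Nat.mul_pos hm hd0
  have hfar : ∏ ν ∈ nthRootsFinset (m * d) (1 : K) with ν ^ m ≠ 1, ‖1 - ν‖ = ‖(d : K)‖ := by
    rw [← norm_prod, prod_one_sub_nthRoots_filter_pow_ne_one hm hd0 hω]
  have hcard : #(nthRootsFinset m (1 : K)) = m :=
    (hω.pow hmd (mul_comm m d)).card_nthRootsFinset
  have hnear : ∀ ν ∈ nthRootsFinset m (1 : K), ‖1 - ν‖ ≤ R := fun ν hν ↦ by
    rw [Polynomial.mem_nthRootsFinset hm] at hν
    rw [norm_sub_rev]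
    exact (hroots ν (by rw [pow_mul, hν, one_pow])).2 hν
  have htri : ∀ a b c : K, ‖a - c‖ ≤ max ‖a - b‖ ‖b - c‖ := fun a b c ↦ by
    simpa [dist_eq_norm] using dist_triangle_max a b c
  -- Translating by a root of unity `ζ` moves it to `1`.
  have hshift : ∀ ζ : K, ζ ^ (m * d) = 1 → ∀ x : K,
      (z * ζ⁻¹) ^ (m * d) = z ^ (m * d) ∧ ‖z * ζ⁻¹ - x‖ = ‖z - x * ζ‖ := fun ζ hζ x ↦ by
    have hζ0 : ζ ≠ 0 := by
      rintro rfl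
      simp [hmd.ne'] at hζ
    refine ⟨by rw [mul_pow, inv_pow, hζ, inv_one, mul_one], ?_⟩
    have : z - x * ζ = (z * ζ⁻¹ - x) * ζ := by field_simp
    rw [this, norm_mul, norm_eq_one_of_pow_eq_one hmd.ne' hζ, mul_one]
  constructor
  · intro hz
    obtain ⟨ζ, hζmem, hζmin⟩ := exists_min_image (nthRootsFinset (m * d) (1 : K))
      (fun ζ ↦ ‖z - ζ‖) ⟨1, by simp [Polynomial.mem_nthRootsFinset hmd]⟩
    have hζ := (Polynomial.mem_nthRootsFinset hmd 1).1 hζmem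
    refine ⟨ζ, hζ, ?_⟩
    by_contra! hlt
    refine absurd hz (not_le.2 ?_)
    have hmin : ∀ ν ∈ nthRootsFinset (m * d) (1 : K), ‖z - ζ‖ ≤ ‖z * ζ⁻¹ - ν‖ := fun ν hν ↦ by
      rw [(hshift ζ hζ ν).2]
      apply hζmin
      rw [Polynomial.mem_nthRootsFinset hmd] at hν ⊢
      rw [mul_pow, hν, hζ, one_mul]
    have hw : ‖z * ζ⁻¹ - 1‖ = ‖z - ζ‖ := by simpa using (hshift ζ hζ 1).2
    rw [← (hshift ζ hζ 1).1, norm_pow_sub_one_eq_prod hm hd0 hω]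
    have h1 : ‖(d : K)‖ ≤
        ∏ ν ∈ nthRootsFinset (m * d) (1 : K) with ν ^ m ≠ 1, ‖z * ζ⁻¹ - ν‖ := by
      rw [← hfar]
      refine prod_le_prod (fun _ _ ↦ norm_nonneg _) fun ν hν ↦ ?_
      refine (htri 1 (z * ζ⁻¹) ν).trans (max_le ?_ le_rfl)
      rw [norm_sub_rev, hw]
      exact hmin ν (mem_filter.1 hν).1
    have h2 : ‖z - ζ‖ ^ m ≤ ∏ ν ∈ nthRootsFinset m (1 : K), ‖z * ζ⁻¹ - ν‖ := by
      have : ∏ ν ∈ nthRootsFinset m (1 : K), ‖z - ζ‖ = ‖z - ζ‖ ^ m := by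
        rw [prod_const, hcard]
      rw [← this]
      refine prod_le_prod (fun _ _ ↦ norm_nonneg _) fun ν hν ↦ hmin ν ?_
      rw [Polynomial.mem_nthRootsFinset hm] at hν
      rw [Polynomial.mem_nthRootsFinset hmd, pow_mul, hν, one_pow]
    rw [mul_comm ‖(d : K)‖]
    calc R ^ m * ‖(d : K)‖ < ‖z - ζ‖ ^ m * ‖(d : K)‖ :=
          mul_lt_mul_of_pos_right (pow_lt_pow_left₀ hlt hR hm.ne') (norm_pos_iff.2 hd)
      _ ≤ _ := mul_le_mul h2 h1 (norm_nonneg _) (prod_nonneg fun _ _ ↦ norm_nonneg _)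
  · rintro ⟨ζ, hζ, hzζ⟩
    have hw : ‖z * ζ⁻¹ - 1‖ ≤ R := by simpa using (hshift ζ hζ 1).2.trans_le (by simpa using hzζ)
    rw [← (hshift ζ hζ 1).1, norm_pow_sub_one_eq_prod hm hd0 hω, mul_comm ‖(d : K)‖]
    have h1 : ∏ ν ∈ nthRootsFinset (m * d) (1 : K) with ν ^ m ≠ 1, ‖z * ζ⁻¹ - ν‖
        ≤ ‖(d : K)‖ := by
      rw [← hfar]
      refine prod_le_prod (fun _ _ ↦ norm_nonneg _) fun ν hν ↦ ?_
      refine (htri _ 1 ν).trans (max_le ?_ le_rfl)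
      obtain ⟨hν1, hνm⟩ := mem_filter.1 hν
      rw [Polynomial.mem_nthRootsFinset hmd] at hν1
      have := mt (hroots ν hν1).1 hνm
      rw [norm_sub_rev 1 ν]
      linarith
    have h2 : ∏ ν ∈ nthRootsFinset m (1 : K), ‖z * ζ⁻¹ - ν‖ ≤ R ^ m := by
      have : ∏ ν ∈ nthRootsFinset m (1 : K), R = R ^ m := by rw [prod_const, hcard]
      rw [← this]
      refine prod_le_prod (fun _ _ ↦ norm_nonneg _) fun ν hν ↦ ?_
      exact (htri _ 1 ν).trans (max_le hw (hnear ν hν))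
    exact mul_le_mul h2 h1 (prod_nonneg fun _ _ ↦ norm_nonneg _) (by positivity)

theorem ncard_closedBall_roots (hm : 0 < m) (hd : 0 < d) (hω : IsPrimitiveRoot ω (m * d))
    (hR : 0 ≤ R) (hroots : ∀ ν : K, ν ^ (m * d) = 1 → (‖ν - 1‖ ≤ R ↔ ν ^ m = 1)) :
    {B : Set K | ∃ ζ : K, ζ ^ (m * d) = 1 ∧ B = Metric.closedBall ζ R}.ncard = d := by
  classical
  have hmd : 0 < m * d := Nat.mul_pos hm hd
  have himage : {B : Set K | ∃ ζ : K, ζ ^ (m * d) = 1 ∧ B = Metric.closedBall ζ R}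
      = ((nthRootsFinset (m * d) (1 : K)).image fun ζ ↦ Metric.closedBall ζ R : Set (Set K)) := by
    ext B
    simp [Polynomial.mem_nthRootsFinset hmd, eq_comm]
  have hcount := card_eq_sum_card_image (fun ζ ↦ Metric.closedBall ζ R)
    (nthRootsFinset (m * d) (1 : K))
  rw [hω.card_nthRootsFinset, sum_const_nat (m := m)] at hcount
  · rw [himage, Set.ncard_coe_finset]
    exact (Nat.eq_of_mul_eq_mul_left hm (hcount.trans (mul_comm _ _))).symm
  intro B hB
  obtain ⟨ζ, hζ, rfl⟩ := mem_image.1 hB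
  rw [Polynomial.mem_nthRootsFinset hmd] at hζ
  rw [← Set.ncard_coe_finset]
  refine Eq.trans ?_ (ncard_roots_mem_closedBall hm hd hω hroots hζ)
  congr 1
  ext ξ
  simp only [coe_filter, Polynomial.mem_nthRootsFinset hmd, Set.mem_ofPred_eq]
  refine and_congr_right fun _ ↦ ⟨fun h ↦ h ▸ Metric.mem_closedBall_self hR,
    fun h ↦ (closedBall_eq_of_mem h).symm⟩

end Preimage

end IsUltrametricDist


/-- With `K` algebraically closed, complete, nonarchimedean, `‖p‖ = p⁻¹`:
for `e ≥ 1`, `0 ≤ i ≤ e - 1`, and `r` with `p^(-i - p/(p-1)) ≤ r`, `r < p^(-i - 1/(p-1))`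
if `i ≥ 1`, and `r < 1` if `i = 0`, the set `{z : ‖z^(p^e) - 1‖ ≤ r}` is the union over
`p^e`-th roots of unity `ζ` of the closed balls `B̄(ζ, (p^i r)^(1/p^(e-i)))`; each such
ball contains exactly `p^(e-i)` of the `p^e`-th roots of unity, the collection of balls
has exactly `p^i` members, and these balls are pairwise disjoint. -/
theorem preimages_of_ball_under_pe_power_map
    {K : Type*} [NormedField K] [IsAlgClosed K] [CompleteSpace K] [IsUltrametricDist K]
    (p : ℕ) (hp : p.Prime) (hpK : ‖(p : K)‖ = (p : ℝ)⁻¹)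
    (e i : ℕ) (he : 1 ≤ e) (hie : i ≤ e - 1) (r : ℝ)
    (hrlow : (p : ℝ) ^ (-(i : ℝ) - (p : ℝ) / ((p : ℝ) - 1)) ≤ r)
    (hrhigh : 1 ≤ i → r < (p : ℝ) ^ (-(i : ℝ) - 1 / ((p : ℝ) - 1)))
    (hrhigh0 : i = 0 → r < 1) :
    ({z : K | ‖z ^ (p ^ e) - 1‖ ≤ r} =
      ⋃ ζ ∈ {ζ : K | ζ ^ (p ^ e) = 1},
        Metric.closedBall ζ (((p : ℝ) ^ i * r) ^ (1 / (p : ℝ) ^ (e - i)))) ∧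
    (∀ ζ : K, ζ ^ (p ^ e) = 1 →
      Set.ncard {ξ : K | ξ ^ (p ^ e) = 1 ∧
        ξ ∈ Metric.closedBall ζ (((p : ℝ) ^ i * r) ^ (1 / (p : ℝ) ^ (e - i)))} = p ^ (e - i)) ∧
    (Set.ncard {B : Set K | ∃ ζ : K, ζ ^ (p ^ e) = 1 ∧
        B = Metric.closedBall ζ (((p : ℝ) ^ i * r) ^ (1 / (p : ℝ) ^ (e - i)))} = p ^ i) ∧
    (∀ ζ ζ' : K, ζ ^ (p ^ e) = 1 → ζ' ^ (p ^ e) = 1 →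
      Metric.closedBall ζ (((p : ℝ) ^ i * r) ^ (1 / (p : ℝ) ^ (e - i))) ≠
        Metric.closedBall ζ' (((p : ℝ) ^ i * r) ^ (1 / (p : ℝ) ^ (e - i))) →
      Disjoint (Metric.closedBall ζ (((p : ℝ) ^ i * r) ^ (1 / (p : ℝ) ^ (e - i))))
        (Metric.closedBall ζ' (((p : ℝ) ^ i * r) ^ (1 / (p : ℝ) ^ (e - i))))) := by
  have hp1 : (1 : ℝ) < p := mod_cast hp.one_lt
  have hp0 : (0 : ℝ) < p := by linarith
  have hq : (0 : ℝ) < (p : ℝ) - 1 := by linarith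
  have hpK0 : (p : K) ≠ 0 := by
    rw [← norm_pos_iff, hpK]
    positivity
  have hsplit : p ^ e = p ^ (e - i) * p ^ i := by
    rw [← pow_add, Nat.sub_add_cancel (by omega)]
  have hm : 0 < p ^ (e - i) := pow_pos hp.pos _
  have hd : 0 < p ^ i := pow_pos hp.pos _
  have : NeZero (p : K) := ⟨hpK0⟩
  obtain ⟨ω, hω⟩ := HasEnoughRootsOfUnity.exists_primitiveRoot K (p ^ e)
  rw [hsplit] at hω
  have hr : 0 < r := (Real.rpow_pos_of_pos hp0 _).trans_le hrlow
  have hpr : 0 < (p : ℝ) ^ i * r := by positivity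
  set R : ℝ := ((p : ℝ) ^ i * r) ^ (1 / (p : ℝ) ^ (e - i)) with hRdef
  have hR : 0 ≤ R := Real.rpow_nonneg hpr.le _
  have hRm : R ^ p ^ (e - i) = (p : ℝ) ^ i * r := by
    rw [hRdef, one_div, ← Nat.cast_pow p (e - i), Real.rpow_inv_natCast_pow hpr.le hm.ne']
  have hq1 : ((p - 1 : ℕ) : ℝ) = (p : ℝ) - 1 := by
    rw [Nat.cast_sub hp.one_le, Nat.cast_one]
  have hscale : ∀ t : ℝ, (p : ℝ) ^ i * (p : ℝ) ^ (-(i : ℝ) - t / ((p : ℝ) - 1)) =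
      (p : ℝ) ^ (-t / ((p : ℝ) - 1)) := fun t ↦ by
    rw [← Real.rpow_natCast, ← Real.rpow_add hp0]
    congr 1
    ring
  have hpow : ∀ t : ℝ, ((p : ℝ) ^ (-t / ((p : ℝ) - 1))) ^ (p - 1) = (p : ℝ) ^ (-t) := fun t ↦ by
    rw [← Real.rpow_natCast, ← Real.rpow_mul hp0.le, hq1, div_mul_cancel₀ _ hq.ne']
  have hlow : ‖(p : K)‖ ^ p ≤ R ^ (p ^ (e - i) * (p - 1)) := by
    have h := mul_le_mul_of_nonneg_left hrlow (pow_nonneg hp0.le i)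
    rw [hscale] at h
    rw [pow_mul, hRm, hpK, inv_pow, ← Real.rpow_natCast, ← Real.rpow_neg hp0.le, ← hpow]
    gcongr
  have hhigh : 1 ≤ i → R ^ (p ^ (e - i) * (p - 1)) < ‖(p : K)‖ := fun hi ↦ by
    have h := mul_lt_mul_of_pos_left (hrhigh hi) (pow_pos hp0 i)
    rw [hscale] at h
    rw [pow_mul, hRm, hpK, ← Real.rpow_neg_one, ← hpow]
    exact pow_lt_pow_left₀ h hpr.le (Nat.sub_ne_zero_of_lt hp.one_lt)
  have hexp : p ^ (e - i) * (p - 1) ≠ 0 :=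
    mul_ne_zero hm.ne' (Nat.sub_ne_zero_of_lt hp.one_lt)
  have hroots : ∀ ν : K, ν ^ (p ^ (e - i) * p ^ i) = 1 → (‖ν - 1‖ ≤ R ↔ ν ^ p ^ (e - i) = 1) := by
    intro ν hν
    constructor
    · intro hle
      by_contra hne
      rcases Nat.eq_zero_or_pos i with rfl | hi
      · exact hne (by simpa using hν)
      · rw [← hsplit] at hν
        have h1 := IsUltrametricDist.le_norm_sub_one_pow_of_pow_ne_one hp hν hne
        have h2 := pow_le_pow_left₀ (norm_nonneg _) hle (p ^ (e - i) * (p - 1))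
        linarith [hhigh hi]
    · intro h
      exact le_of_pow_le_pow_left₀ hexp hR
        ((IsUltrametricDist.norm_sub_one_pow_le_of_pow_eq_one hp h).trans hlow)
  have hrd : r = ‖((p ^ i : ℕ) : K)‖ * R ^ p ^ (e - i) := by
    rw [hRm, Nat.cast_pow, norm_pow, hpK, ← mul_assoc, ← mul_pow, inv_mul_cancel₀ hp0.ne', one_pow,
      one_mul]
  have hdK : ((p ^ i : ℕ) : K) ≠ 0 := by
    rw [Nat.cast_pow]
    exact pow_ne_zero _ hpK0
  rw [hsplit]
  refine ⟨?_, fun ζ hζ ↦ IsUltrametricDist.ncard_roots_mem_closedBall hm hd hω hroots hζ,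
    IsUltrametricDist.ncard_closedBall_roots hm hd hω hR hroots,
    fun ζ ζ' _ _ hne ↦ (IsUltrametricDist.closedBall_eq_or_disjoint ζ ζ' R).resolve_left hne⟩
  ext z
  simp only [Set.mem_ofPred_eq, Set.mem_iUnion, Metric.mem_closedBall, dist_eq_norm, exists_prop]
  rw [hrd]
  exact IsUltrametricDist.norm_pow_sub_one_le_iff hm hdK hω hR hroots z
end

section
/- Let e ≥ 1 be an integer and let r be a real number with 0 < r < p^(−e − 1/(p−1)). Then: (i) the p^e closed balls B̄(ζ, p^e·r), for ζ ranging over the p^e-th roots of unity of K, are pairwise disjoint, and each contains exactly one p^e-th root of unity; (ii) the set {z ∈ K : ‖z^(p^e) − 1‖ ≤ r} equals the union of these balls; (iii) the map z ↦ z^(p^e) restricts to a bijection from each ball B̄(ζ, p^e·r) onto the closed ball B̄(1, r). -/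
open Polynomial in
/-- In an algebraically closed normed field, some `n`-th root `y` of `a` satisfies
`‖x - y‖ ^ n ≤ ‖x ^ n - a‖`. -/
theorem exists_pow_eq_and_norm_sub_pow_le {K : Type*} [NormedField K] [IsAlgClosed K]
    {n : ℕ} (hn : n ≠ 0) (x a : K) : ∃ y : K, y ^ n = a ∧ ‖x - y‖ ^ n ≤ ‖x ^ n - a‖ := by
  have hm : (X ^ n - C a : K[X]).Monic := monic_X_pow_sub_C a hn
  have hs := IsAlgClosed.splits (X ^ n - C a : K[X])
  have hcard : Multiset.card (X ^ n - C a : K[X]).roots = n := by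
    rw [← hs.natDegree_eq_card_roots, natDegree_X_pow_sub_C]
  have hne : (X ^ n - C a : K[X]).roots ≠ 0 := by
    intro h
    simp only [h, Multiset.card_zero] at hcard
    exact hn hcard.symm
  obtain ⟨y, hy, hmin⟩ := Multiset.exists_min_image (fun y ↦ ‖x - y‖) hne
  refine ⟨y, by simpa [sub_eq_zero] using isRoot_of_mem_roots hy, ?_⟩
  have hle := Multiset.prod_map_le_prod_map₀ (fun _ ↦ ‖x - y‖) (fun b ↦ ‖x - b‖)
    (fun _ _ ↦ norm_nonneg _) hmin
  have heval := congrArg norm (hs.eval_eq_prod_roots_of_monic hm x)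
  have hprod : ((X ^ n - C a : K[X]).roots.map fun b ↦ ‖x - b‖).prod =
      ‖((X ^ n - C a : K[X]).roots.map fun b ↦ x - b).prod‖ :=
    Multiset.prod_hom' (X ^ n - C a : K[X]).roots (normHom : K →*₀ ℝ) (x - ·)
  rw [Multiset.map_const', Multiset.prod_replicate, hcard, hprod, ← heval] at hle
  simpa using hle

section NormPowPrime

variable {K : Type*} [NormedField K] [IsUltrametricDist K] {p : ℕ} {ρ : ℝ}

/-- On the open ball of radius `p ^ (-1 / (p - 1))` around `1`, the map `u ↦ u ^ p` divides the
distance to `1` by `p`. -/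
theorem norm_pow_prime_sub_one (hp : p.Prime) (hpK : ‖(p : K)‖ = (p : ℝ)⁻¹)
    (hρ : ρ ^ (p - 1) = (p : ℝ)⁻¹) (hρ1 : ρ ≤ 1) {u : K} (hu : ‖u - 1‖ < ρ) :
    ‖u ^ p - 1‖ = (p : ℝ)⁻¹ * ‖u - 1‖ := by
  obtain ⟨w, rfl⟩ : ∃ w, u = w + 1 := ⟨u - 1, by ring⟩
  simp only [add_sub_cancel_right] at hu ⊢
  rcases eq_or_ne w 0 with rfl | hw
  · simp
  have hw0 : 0 < ‖w‖ := norm_pos_iff.2 hw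
  have hp0 : (0 : ℝ) < (p : ℝ)⁻¹ := by have := hp.pos; positivity
  set S : K := ∑ k ∈ Finset.Ioo 0 p, w ^ (k - 1) * 1 ^ (p - k - 1) * ((p.choose k / p : ℕ) : K)
    with hS
  have hS1 : ‖S - 1‖ ≤ ‖w‖ := by
    have hIoo : Finset.Ioo 0 p = insert 1 (Finset.Ioo 1 p) := by
      ext k
      have := hp.one_lt
      simp only [Finset.mem_Ioo, Finset.mem_insert]
      omega
    rw [hS, hIoo, Finset.sum_insert (by simp)]
    simp only [tsub_self, pow_zero, one_pow, mul_one, Nat.choose_one_right,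
      Nat.div_self hp.pos, Nat.cast_one, add_sub_cancel_left]
    refine IsUltrametricDist.norm_sum_le_of_forall_le_of_nonneg hw0.le fun k hk ↦ ?_
    rw [Finset.mem_Ioo] at hk
    rw [norm_mul, norm_pow]
    calc ‖w‖ ^ (k - 1) * ‖((p.choose k / p : ℕ) : K)‖ ≤ ‖w‖ ^ (k - 1) * 1 := by
          gcongr
          exact IsUltrametricDist.norm_natCast_le_one K _
      _ ≤ ‖w‖ := by
          rw [mul_one]
          exact pow_le_of_le_one hw0.le (hu.le.trans hρ1) (by omega)
  have hSn : ‖S‖ = 1 := by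
    have h := IsUltrametricDist.norm_add_eq_max_of_norm_ne_norm (x := S - 1) (y := 1)
      (by rw [norm_one]; linarith)
    rwa [sub_add_cancel, norm_one, max_eq_right (by linarith)] at h
  have hpw : ‖(p : K) * w * 1 * S‖ = (p : ℝ)⁻¹ * ‖w‖ := by
    simp [hpK, hSn]
  have hlt : ‖w ^ p‖ < ‖(p : K) * w * 1 * S‖ := by
    rw [hpw, norm_pow, ← Nat.sub_add_cancel hp.one_le, pow_succ, Nat.sub_add_cancel hp.one_le,
      ← hρ]
    have := hp.two_le
    gcongr
    omega
  have heq : (w + 1) ^ p - 1 = w ^ p + (p : K) * w * 1 * S := by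
    rw [add_pow_prime_eq hp w 1]
    ring
  rw [heq, IsUltrametricDist.norm_add_eq_max_of_norm_ne_norm hlt.ne, max_eq_right hlt.le, hpw]

/-- On the open ball of radius `p ^ (-1 / (p - 1))` around `1`, the map `u ↦ u ^ p ^ e` divides
the distance to `1` by `p ^ e`. -/
theorem norm_pow_prime_pow_sub_one (hp : p.Prime) (hpK : ‖(p : K)‖ = (p : ℝ)⁻¹)
    (hρ : ρ ^ (p - 1) = (p : ℝ)⁻¹) (hρ1 : ρ ≤ 1) (e : ℕ) {u : K} (hu : ‖u - 1‖ < ρ) :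
    (p : ℝ) ^ e * ‖u ^ p ^ e - 1‖ = ‖u - 1‖ := by
  have hp1 : (1 : ℝ) ≤ p := by exact_mod_cast hp.one_le
  have hp0 : (p : ℝ) ≠ 0 := by positivity
  induction e with
  | zero => simp
  | succ e ih =>
    have hlt : ‖u ^ p ^ e - 1‖ < ρ := by
      refine lt_of_le_of_lt ?_ hu
      rw [← ih]
      exact le_mul_of_one_le_left (norm_nonneg _) (one_le_pow₀ hp1)
    rw [pow_succ p e, pow_mul, norm_pow_prime_sub_one hp hpK hρ hρ1 hlt, ← ih]
    field_simp
    ring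

/-- Elements sufficiently close to `1` have a `p ^ e`-th root in the open ball of radius
`p ^ (-1 / (p - 1))` around `1`. -/
theorem exists_pow_prime_pow_eq [IsAlgClosed K] (hp : p.Prime) (hpK : ‖(p : K)‖ = (p : ℝ)⁻¹)
    (hρ0 : 0 < ρ) (hρ : ρ ^ (p - 1) = (p : ℝ)⁻¹) (hρ1 : ρ ≤ 1) (e : ℕ) {a : K}
    (ha : (p : ℝ) ^ e * ‖a - 1‖ < ρ) : ∃ y : K, y ^ p ^ e = a ∧ ‖y - 1‖ < ρ := by
  have hp1 : (1 : ℝ) ≤ p := by exact_mod_cast hp.one_le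
  have hp0 : (0 : ℝ) < p := by positivity
  induction e generalizing a with
  | zero => exact ⟨a, by simp, by simpa using ha⟩
  | succ e ih =>
    obtain ⟨b, rfl, hb⟩ := exists_pow_eq_and_norm_sub_pow_le hp.ne_zero (1 : K) a
    rw [one_pow, norm_sub_rev, norm_sub_rev 1] at hb
    have hbρ : ‖b - 1‖ < ρ := by
      refine lt_of_pow_lt_pow_left₀ p hρ0.le (hb.trans_lt ?_)
      rw [← Nat.sub_add_cancel hp.one_le, pow_succ ρ, Nat.sub_add_cancel hp.one_le, hρ,
        lt_inv_mul_iff₀ hp0]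
      refine lt_of_le_of_lt ?_ ha
      gcongr
      exact le_self_pow₀ hp1 e.succ_ne_zero
    rw [norm_pow_prime_sub_one hp hpK hρ hρ1 hbρ, pow_succ, mul_assoc,
      mul_inv_cancel_left₀ hp0.ne'] at ha
    obtain ⟨y, hy, hyρ⟩ := ih ha
    exact ⟨y, by rw [pow_succ, pow_mul, hy], hyρ⟩

end NormPowPrime

/-- With `K` algebraically closed, complete, nonarchimedean, `‖p‖ = p⁻¹`:
for `e ≥ 1` and `0 < r < p^(-e - 1/(p-1))`, (i) the closed balls `B̄(ζ, p^e r)` for `ζ`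
ranging over the `p^e`-th roots of unity are pairwise disjoint and each contains exactly
one `p^e`-th root of unity; (ii) `{z : ‖z^(p^e) - 1‖ ≤ r}` is the union of these balls;
(iii) `z ↦ z^(p^e)` restricts to a bijection from each ball onto `B̄(1, r)`. -/
theorem split_fibers_of_pe_power_map
    {K : Type*} [NormedField K] [IsAlgClosed K] [CompleteSpace K] [IsUltrametricDist K]
    (p : ℕ) (hp : p.Prime) (hpK : ‖(p : K)‖ = (p : ℝ)⁻¹)
    (e : ℕ) (he : 1 ≤ e) (r : ℝ) (hr0 : 0 < r)
    (hr1 : r < (p : ℝ) ^ (-(e : ℝ) - 1 / ((p : ℝ) - 1))) :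
    (∀ ζ ζ' : K, ζ ^ (p ^ e) = 1 → ζ' ^ (p ^ e) = 1 → ζ ≠ ζ' →
      Disjoint (Metric.closedBall ζ ((p : ℝ) ^ e * r))
        (Metric.closedBall ζ' ((p : ℝ) ^ e * r))) ∧
    (∀ ζ : K, ζ ^ (p ^ e) = 1 →
      {ξ : K | ξ ^ (p ^ e) = 1 ∧ ξ ∈ Metric.closedBall ζ ((p : ℝ) ^ e * r)} = {ζ}) ∧
    ({z : K | ‖z ^ (p ^ e) - 1‖ ≤ r} =
      ⋃ ζ ∈ {ζ : K | ζ ^ (p ^ e) = 1}, Metric.closedBall ζ ((p : ℝ) ^ e * r)) ∧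
    (∀ ζ : K, ζ ^ (p ^ e) = 1 →
      Set.BijOn (fun z : K => z ^ (p ^ e)) (Metric.closedBall ζ ((p : ℝ) ^ e * r))
        (Metric.closedBall (1 : K) r)) := by
  have hp1 : (1 : ℝ) < p := by exact_mod_cast hp.one_lt
  have hp0 : (0 : ℝ) < p := by linarith
  have hpe : p ^ e ≠ 0 := pow_ne_zero _ hp.ne_zero
  obtain ⟨ρ, hρ0, hρ, hρ1, hrρ⟩ : ∃ ρ : ℝ, 0 < ρ ∧ ρ ^ (p - 1) = (p : ℝ)⁻¹ ∧ ρ ≤ 1 ∧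
      (p : ℝ) ^ e * r < ρ := by
    refine ⟨(p : ℝ) ^ (-(1 / ((p : ℝ) - 1))), by positivity, ?_, ?_, ?_⟩
    · rw [← Real.rpow_natCast, ← Real.rpow_mul hp0.le, Nat.cast_sub hp.one_le, Nat.cast_one,
        neg_mul, one_div_mul_cancel (by linarith), Real.rpow_neg_one]
    · refine Real.rpow_le_one_of_one_le_of_nonpos hp1.le ?_
      rw [neg_nonpos]
      exact one_div_nonneg.2 (by linarith)
    · rw [sub_eq_add_neg, Real.rpow_add hp0, Real.rpow_neg hp0.le, Real.rpow_natCast] at hr1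
      exact (lt_inv_mul_iff₀ (by positivity)).1 hr1
  have hnorm : ∀ {ζ : K}, ζ ^ p ^ e = 1 → ‖ζ‖ = 1 := by
    intro ζ hζ
    rw [← pow_eq_one_iff_of_nonneg (norm_nonneg ζ) hpe, ← norm_pow, hζ, norm_one]
  have hscale : ∀ {z z' : K}, ‖z'‖ = 1 → ‖z - z'‖ < ρ →
      (p : ℝ) ^ e * ‖z ^ p ^ e - z' ^ p ^ e‖ = ‖z - z'‖ := by
    intro z z' hn hz
    have hz0 : z' ≠ 0 := by
      rw [← norm_ne_zero_iff, hn]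
      exact one_ne_zero
    have h1 : ‖z / z' - 1‖ = ‖z - z'‖ := by rw [div_sub_one hz0, norm_div, hn, div_one]
    have h2 := norm_pow_prime_pow_sub_one hp hpK hρ hρ1 e (h1.trans_lt hz)
    rwa [h1, div_pow, div_sub_one (pow_ne_zero _ hz0), norm_div, norm_pow z', hn, one_pow,
      div_one] at h2
  have heq : ∀ {z z' : K}, z ^ p ^ e = z' ^ p ^ e → ‖z'‖ = 1 → ‖z - z'‖ < ρ → z = z' := by
    intro z z' h hn hz
    have h2 := hscale hn hz
    rwa [h, sub_self, norm_zero, mul_zero, eq_comm, norm_eq_zero, sub_eq_zero] at h2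
  have hroot : ∀ {a : K}, ‖a - 1‖ ≤ r → ∃ y : K, y ^ p ^ e = a ∧ ‖y - 1‖ ≤ (p : ℝ) ^ e * r := by
    intro a ha
    have hle : (p : ℝ) ^ e * ‖a - 1‖ ≤ (p : ℝ) ^ e * r := by gcongr
    obtain ⟨y, rfl, hy⟩ := exists_pow_prime_pow_eq hp hpK hρ0 hρ hρ1 e (hle.trans_lt hrρ)
    exact ⟨y, rfl, (norm_pow_prime_pow_sub_one hp hpK hρ hρ1 e hy).symm.trans_le hle⟩
  have hmaps : ∀ {ζ z : K}, ζ ^ p ^ e = 1 → ‖z - ζ‖ ≤ (p : ℝ) ^ e * r → ‖z ^ p ^ e - 1‖ ≤ r := by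
    intro ζ z hζ hz
    rw [← hscale (hnorm hζ) (hz.trans_lt hrρ), hζ] at hz
    exact le_of_mul_le_mul_left hz (by positivity)
  have hR : 0 ≤ (p : ℝ) ^ e * r := by positivity
  refine ⟨fun ζ ζ' hζ hζ' hne ↦ ?_, fun ζ hζ ↦ ?_, ?_, fun ζ hζ ↦ ⟨fun z hz ↦ ?_, ?_, ?_⟩⟩
  · refine (IsUltrametricDist.closedBall_eq_or_disjoint ζ ζ' _).resolve_left fun h ↦ hne ?_
    have hmem := h ▸ Metric.mem_closedBall_self (x := ζ) hR
    rw [mem_closedBall_iff_norm] at hmem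
    exact heq (hζ.trans hζ'.symm) (hnorm hζ') (hmem.trans_lt hrρ)
  · ext ξ
    simp only [Set.mem_ofPred_eq, Set.mem_singleton_iff, mem_closedBall_iff_norm]
    constructor
    · rintro ⟨hξ, hd⟩
      exact heq (hξ.trans hζ.symm) (hnorm hζ) (hd.trans_lt hrρ)
    · rintro rfl
      exact ⟨hζ, by simpa using hR⟩
  · ext z
    simp only [Set.mem_ofPred_eq, Set.mem_iUnion, mem_closedBall_iff_norm, exists_prop]
    constructor
    · intro hz
      obtain ⟨y, hy, hy1⟩ := hroot hz
      have hyn : ‖y‖ = 1 := by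
        have h := IsUltrametricDist.norm_add_eq_max_of_norm_ne_norm (x := y - 1) (y := 1)
          (by rw [norm_one]; linarith)
        rwa [sub_add_cancel, norm_one, max_eq_right (by linarith)] at h
      have hy0 : y ≠ 0 := by rintro rfl; simp at hyn
      have hζ : (z / y) ^ p ^ e = 1 := by
        rw [div_pow, hy, div_self]
        rw [← hy]
        exact pow_ne_zero _ hy0
      refine ⟨z / y, hζ, ?_⟩
      have hz' : z - z / y = z / y * (y - 1) := by field_simp
      rwa [hz', norm_mul, hnorm hζ, one_mul]
    · rintro ⟨ζ, hζ, hz⟩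
      exact hmaps hζ hz
  · rw [mem_closedBall_iff_norm] at hz ⊢
    exact hmaps hζ hz
  · intro z hz z' hz' h
    have hd : z ∈ Metric.closedBall z' ((p : ℝ) ^ e * r) := by
      rwa [IsUltrametricDist.closedBall_eq_of_mem hz'] at hz
    rw [mem_closedBall_iff_norm] at hz' hd
    refine heq h ?_ (hd.trans_lt hrρ)
    have hn := IsUltrametricDist.norm_add_eq_max_of_norm_ne_norm (x := z' - ζ) (y := ζ)
      (by rw [hnorm hζ]; linarith)
    rwa [sub_add_cancel, hnorm hζ, max_eq_right (by linarith)] at hn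
  · intro a ha
    rw [mem_closedBall_iff_norm] at ha
    obtain ⟨y, hy, hy1⟩ := hroot ha
    refine ⟨ζ * y, ?_, ?_⟩
    · rwa [mem_closedBall_iff_norm, ← mul_sub_one, norm_mul, hnorm hζ, one_mul]
    · simp only [mul_pow, hζ, hy, one_mul]
end

section
/- Let h ∈ K with ‖h‖ = 1 and let r be a real number with 0 < r < 1. Then the image of the closed ball B̄(h, r) under the map z ↦ z^p is exactly the closed ball B̄(h^p, r′), where r′ = max(r^p, r/p); equivalently, r′ = r·p⁻¹ if r ≤ p^(−1/(p−1)) and r′ = r^p if r ≥ p^(−1/(p−1)). -/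
open Polynomial in
/-- If no root of a nonconstant split monic polynomial `f` lies within distance `r` of `x`, then
`r ^ deg f < ‖f(x)‖`. -/
lemma pow_natDegree_lt_norm_eval {K : Type*} [NormedField K] {f : K[X]} (hf : f.Splits)
    (hm : f.Monic) (hdeg : f.natDegree ≠ 0) {x : K} {r : ℝ} (hr : 0 < r)
    (hroots : ∀ z ∈ f.roots, r < ‖x - z‖) : r ^ f.natDegree < ‖f.eval x‖ := by
  have hne : f.roots ≠ 0 := by
    rw [← Multiset.card_pos, ← hf.natDegree_eq_card_roots]
    exact Nat.pos_of_ne_zero hdeg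
  have hlt := Multiset.prod_map_lt_prod_map hne (fun _ ↦ r) (fun z ↦ ‖x - z‖)
    (fun _ _ ↦ hr) hroots
  rw [Multiset.map_const', Multiset.prod_replicate, ← hf.natDegree_eq_card_roots] at hlt
  refine hlt.trans_eq ?_
  rw [hf.eval_eq_prod_roots_of_monic hm, ← normHom_apply, map_multiset_prod, Multiset.map_map]
  rfl

open Polynomial in
/-- If no root of a nonconstant split polynomial `f` over a nonarchimedean field lies within
distance `r` of `x`, then `r * ‖f'(x)‖ < ‖f(x)‖`. -/
lemma mul_norm_eval_derivative_lt_norm_eval {K : Type*} [NormedField K] [IsUltrametricDist K]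
    {f : K[X]} (hf : f.Splits) {x : K} (hx : f.eval x ≠ 0) (hdeg : f.natDegree ≠ 0)
    {r : ℝ} (hr : 0 < r) (hroots : ∀ z ∈ f.roots, r < ‖x - z‖) :
    r * ‖f.derivative.eval x‖ < ‖f.eval x‖ := by
  have hne : f.roots ≠ 0 := by
    rw [← Multiset.card_pos, ← hf.natDegree_eq_card_roots]
    exact Nat.pos_of_ne_zero hdeg
  obtain ⟨z, hz, hle⟩ := IsUltrametricDist.exists_norm_multiset_sum_le f.roots
    (f := fun z ↦ 1 / (x - z))
  have hrz := hroots z (hz hne)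
  rw [← hf.eval_derivative_div_eval_of_ne_zero hx, norm_div, norm_div, norm_one,
    div_le_div_iff₀ (norm_pos_iff.2 hx) (hr.trans hrz), one_mul] at hle
  rcases (norm_nonneg (f.derivative.eval x)).eq_or_lt with h0 | h0
  · rw [← h0, mul_zero]
    exact norm_pos_iff.2 hx
  · calc r * ‖f.derivative.eval x‖ < ‖x - z‖ * ‖f.derivative.eval x‖ := by gcongr
      _ ≤ ‖f.eval x‖ := by rwa [mul_comm]

/-- On the unit ball of a nonarchimedean field, the `p`-power map satisfies
`‖(x + y) ^ p - x ^ p‖ ≤ max (‖y‖ ^ p) (‖p‖ * ‖y‖)`. -/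
lemma norm_add_pow_prime_sub_pow_le {K : Type*} [NormedField K] [IsUltrametricDist K]
    {p : ℕ} (hp : p.Prime) {x y : K} (hx : ‖x‖ ≤ 1) (hy : ‖y‖ ≤ 1) :
    ‖(x + y) ^ p - x ^ p‖ ≤ max (‖y‖ ^ p) (‖(p : K)‖ * ‖y‖) := by
  rw [add_pow_prime_eq hp, add_assoc, add_sub_cancel_left]
  refine (IsUltrametricDist.norm_add_le_max _ _).trans (max_le_max (norm_pow _ _).le ?_)
  set S := ∑ k ∈ Finset.Ioo 0 p, x ^ (k - 1) * y ^ (p - k - 1) * ((p.choose k / p : ℕ) : K)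
  have hS : ‖S‖ ≤ 1 := by
    refine IsUltrametricDist.norm_sum_le_of_forall_le_of_nonneg zero_le_one fun k _ ↦ ?_
    rw [norm_mul, norm_mul, norm_pow, norm_pow]
    exact mul_le_one₀ (mul_le_one₀ (pow_le_one₀ (norm_nonneg _) hx) (by positivity)
      (pow_le_one₀ (norm_nonneg _) hy)) (norm_nonneg _)
      (IsUltrametricDist.norm_natCast_le_one K _)
  calc ‖(p : K) * x * y * S‖ = ‖(p : K)‖ * ‖y‖ * (‖x‖ * ‖S‖) := by
        rw [norm_mul, norm_mul, norm_mul]; ring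
    _ ≤ ‖(p : K)‖ * ‖y‖ :=
      mul_le_of_le_one_right (by positivity) (mul_le_one₀ hx (norm_nonneg _) hS)

open Polynomial in
/-- Every point of the closed ball of radius `max (r ^ p) (r * ‖p‖)` around `h ^ p` has a `p`-th
root within distance `r` of `h`. -/
lemma exists_pow_eq_of_norm_sub_pow_le {K : Type*} [NormedField K] [IsAlgClosed K]
    [IsUltrametricDist K] {p : ℕ} (hp : p ≠ 0) {h y : K} (hh : ‖h‖ = 1) {r : ℝ} (hr : 0 < r)
    (hy : ‖y - h ^ p‖ ≤ max (r ^ p) (r * ‖(p : K)‖)) : ∃ z, ‖z - h‖ ≤ r ∧ z ^ p = y := by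
  by_contra! hcon
  have hm : (X ^ p - C y).Monic := monic_X_pow_sub_C y hp
  have hs : (X ^ p - C y).Splits := IsAlgClosed.splits _
  have hdeg : (X ^ p - C y).natDegree = p := natDegree_X_pow_sub_C
  have hroots : ∀ z ∈ (X ^ p - C y).roots, r < ‖h - z‖ := fun z hz ↦ by
    rw [norm_sub_rev]
    by_contra! hle
    refine hcon z hle ?_
    simpa [sub_eq_zero] using isRoot_of_mem_roots hz
  have hpow := pow_natDegree_lt_norm_eval hs hm (hdeg.trans_ne hp) hr hroots
  have hne : (X ^ p - C y).eval h ≠ 0 := norm_pos_iff.1 ((pow_pos hr _).trans hpow)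
  have hder := mul_norm_eval_derivative_lt_norm_eval hs hne (hdeg.trans_ne hp) hr hroots
  rw [hdeg] at hpow
  simp only [derivative_sub, derivative_X_pow, derivative_C, sub_zero, eval_mul, eval_pow, eval_X,
    eval_C, eval_sub, norm_mul, norm_pow, hh, one_pow, mul_one, norm_sub_rev _ y] at hpow hder
  exact (max_lt hpow hder).not_ge hy

/-- The critical radius `p ^ (-1 / (p - 1))` has `(p - 1)`-st power `p⁻¹`. -/
lemma rpow_neg_one_div_sub_one_pow {p : ℕ} (hp : 1 < p) :
    ((p : ℝ) ^ (-(1 : ℝ) / ((p : ℝ) - 1))) ^ (p - 1) = (p : ℝ)⁻¹ := by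
  have hp' : (p : ℝ) - 1 ≠ 0 := sub_ne_zero.2 (by exact_mod_cast hp.ne')
  rw [← Real.rpow_natCast, ← Real.rpow_mul p.cast_nonneg, Nat.cast_pred (by omega),
    div_mul_cancel₀ _ hp', Real.rpow_neg_one]

/-- With `K` algebraically closed, complete, nonarchimedean, `‖p‖ = p⁻¹`:
for `h` with `‖h‖ = 1` and `0 < r < 1`, the image of `B̄(h, r)` under `z ↦ z^p` is exactly
`B̄(h^p, r′)` with `r′ = max (r^p) (r/p)`; equivalently `r′ = r/p` if `r ≤ p^(-1/(p-1))`
and `r′ = r^p` if `r ≥ p^(-1/(p-1))`. -/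
theorem image_closedBall_p_power_map
    {K : Type*} [NormedField K] [IsAlgClosed K] [CompleteSpace K] [IsUltrametricDist K]
    (p : ℕ) (hp : p.Prime) (hpK : ‖(p : K)‖ = (p : ℝ)⁻¹)
    (h : K) (hh : ‖h‖ = 1) (r : ℝ) (hr0 : 0 < r) (hr1 : r < 1) :
    ((fun z : K => z ^ p) '' Metric.closedBall h r =
      Metric.closedBall (h ^ p) (max (r ^ p) (r / p))) ∧
    (r ≤ (p : ℝ) ^ (-(1 : ℝ) / ((p : ℝ) - 1)) → max (r ^ p) (r / p) = r / p) ∧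
    ((p : ℝ) ^ (-(1 : ℝ) / ((p : ℝ) - 1)) ≤ r → max (r ^ p) (r / p) = r ^ p) := by
  have hrp : r ^ p = r * r ^ (p - 1) := by rw [← pow_succ', Nat.sub_add_cancel hp.one_le]
  refine ⟨Set.Subset.antisymm ?_ fun y hy ↦ ?_, fun hle ↦ max_eq_right ?_, fun hle ↦ max_eq_left ?_⟩
  · rintro _ ⟨z, hz, rfl⟩
    rw [mem_closedBall_iff_norm] at hz ⊢
    have hle := norm_add_pow_prime_sub_pow_le hp hh.le (hz.trans hr1.le)
    rw [add_sub_cancel, hpK, inv_mul_eq_div] at hle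
    exact hle.trans (by gcongr)
  · rw [mem_closedBall_iff_norm, div_eq_mul_inv, ← hpK] at hy
    obtain ⟨z, hz, rfl⟩ := exists_pow_eq_of_norm_sub_pow_le hp.ne_zero hh hr0 hy
    exact ⟨z, mem_closedBall_iff_norm.2 hz, rfl⟩
  · rw [hrp, div_eq_mul_inv, ← rpow_neg_one_div_sub_one_pow hp.one_lt]
    gcongr
  · rw [hrp, div_eq_mul_inv, ← rpow_neg_one_div_sub_one_pow hp.one_lt]
    gcongr
end

section
/- Let h, h′, w ∈ K with ‖h‖ = 1 and w^p = h, and let r′ be a real number with 0 < r′ < 1 such that ‖h′^p − h‖ ≤ r′. Then there exists ζ ∈ K with ζ^p = 1 and ‖h′ − ζ·w‖ ≤ r′^(1/p). -/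
open Polynomial in
/-- A monic split polynomial of positive degree has a root within `c` of `x`
as soon as its value at `x` has norm at most `c ^ natDegree`. -/
theorem Polynomial.Splits.exists_mem_roots_norm_sub_le {K : Type*} [NormedField K]
    {f : K[X]} (hs : f.Splits) (hm : f.Monic) (hd : f.natDegree ≠ 0) {c : ℝ} (hc : 0 ≤ c) {x : K}
    (hx : ‖f.eval x‖ ≤ c ^ f.natDegree) : ∃ a ∈ f.roots, ‖x - a‖ ≤ c := by
  by_contra! hfar
  have key : ∀ s : Multiset K, s ≠ 0 → (∀ a ∈ s, c < ‖x - a‖) →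
      c ^ s.card < ‖(s.map (x - ·)).prod‖ := by
    intro s
    induction s using Multiset.induction_on with
    | empty => simp
    | cons a s ih =>
      intro _ hs
      rw [Multiset.forall_mem_cons] at hs
      rw [Multiset.card_cons, Multiset.map_cons, Multiset.prod_cons, norm_mul, pow_succ']
      rcases eq_or_ne s 0 with rfl | hne
      · simpa using hs.1
      · exact mul_lt_mul'' hs.1 (ih hne hs.2) hc (by positivity)
  have hcard : f.natDegree = f.roots.card := hs.natDegree_eq_card_roots
  have hlt := key f.roots (by rintro h0; simp [h0] at hcard; exact hd hcard) hfar
  rw [hs.eval_eq_prod_roots_of_monic hm, hcard] at hx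
  exact absurd hx hlt.not_ge

/-- With `K` algebraically closed, complete, nonarchimedean, `‖p‖ = p⁻¹`:
if `‖h‖ = 1`, `w^p = h`, `0 < r′ < 1` and `‖h′^p - h‖ ≤ r′`, then there is a `p`-th root
of unity `ζ` with `‖h′ - ζ w‖ ≤ r′^(1/p)`. -/
theorem exists_pth_root_of_unity_close_rpow
    {K : Type*} [NormedField K] [IsAlgClosed K] [CompleteSpace K] [IsUltrametricDist K]
    (p : ℕ) (hp : p.Prime) (hpK : ‖(p : K)‖ = (p : ℝ)⁻¹)
    (h h' w : K) (hh : ‖h‖ = 1) (hw : w ^ p = h)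
    (r' : ℝ) (hr0 : 0 < r') (hr1 : r' < 1) (hclose : ‖h' ^ p - h‖ ≤ r') :
    ∃ ζ : K, ζ ^ p = 1 ∧ ‖h' - ζ * w‖ ≤ r' ^ ((1 : ℝ) / p) := by
  have hw0 : w ≠ 0 := by
    rintro rfl
    simp [← hw, hp.ne_zero] at hh
  have hpow : (r' ^ ((1 : ℝ) / p)) ^ p = r' := by
    rw [one_div, Real.rpow_inv_natCast_pow hr0.le hp.ne_zero]
  obtain ⟨a, ha, hle⟩ :=
    (IsAlgClosed.splits (Polynomial.X ^ p - Polynomial.C h)).exists_mem_roots_norm_sub_le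
      (Polynomial.monic_X_pow_sub_C h hp.ne_zero)
      (by rw [Polynomial.natDegree_X_pow_sub_C]; exact hp.ne_zero)
      (Real.rpow_nonneg hr0.le ((1 : ℝ) / p)) (x := h')
      (by rw [Polynomial.natDegree_X_pow_sub_C, hpow]; simpa using hclose)
  have hap : a ^ p = h := by
    simpa [sub_eq_zero] using (Polynomial.mem_roots'.mp ha).2
  refine ⟨a / w, ?_, ?_⟩
  · rw [div_pow, hap, hw, div_self]
    exact hw ▸ pow_ne_zero p hw0
  · rwa [div_mul_cancel₀ a hw0]
end

section
/- Let h, h′, w ∈ K with ‖h‖ = 1 and w^p = h, and let r′ be a real number with 0 < r′ ≤ p^(−p/(p−1)) such that ‖h′^p − h‖ ≤ r′. Then there exists ζ ∈ K with ζ^p = 1 and ‖h′ − ζ·w‖ ≤ p·r′. -/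
open Polynomial in
/-- A Newton-type estimate over an ultrametric field: a root `a` of a split monic polynomial `f`
nearest to `x` satisfies `‖x - a‖ * ‖f.derivative.eval a‖ ≤ ‖f.eval x‖`. -/
theorem Polynomial.Splits.exists_root_norm_sub_mul_norm_derivative_le
    {K : Type*} [NormedField K] [IsUltrametricDist K] {f : K[X]} (hf : f.Splits) (hm : f.Monic)
    (h0 : f.roots ≠ 0) (x : K) :
    ∃ a ∈ f.roots, ‖x - a‖ * ‖f.derivative.eval a‖ ≤ ‖f.eval x‖ := by
  classical
  obtain ⟨a, ha, hmin⟩ := Multiset.exists_min_image (fun b => ‖x - b‖) h0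
  refine ⟨a, ha, ?_⟩
  have norm_prod (c : K) (s : Multiset K) :
      ‖(s.map (c - ·)).prod‖ = (s.map fun b => ‖c - b‖).prod := by
    simpa using map_multiset_prod (normHom : K →*₀ ℝ) (s.map (c - ·))
  rw [hf.eval_root_derivative hm ha, hf.eval_eq_prod_roots_of_monic hm,
    ← Multiset.prod_map_erase ha, norm_mul, norm_prod, norm_prod]
  refine mul_le_mul_of_nonneg_left ?_ (norm_nonneg _)
  refine Multiset.prod_map_le_prod_map₀ _ _ (fun b _ => norm_nonneg _) fun b hb => ?_
  calc ‖a - b‖ = ‖(x - b) + (a - x)‖ := by congr 1; ring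
    _ ≤ max ‖x - b‖ ‖a - x‖ := IsUltrametricDist.norm_add_le_max _ _
    _ = ‖x - b‖ := max_eq_left (norm_sub_rev a x ▸ hmin b (Multiset.mem_of_mem_erase hb))

/-- With `K` algebraically closed, complete, nonarchimedean, `‖p‖ = p⁻¹`:
if `‖h‖ = 1`, `w^p = h`, `0 < r′ ≤ p^(-p/(p-1))` and `‖h′^p - h‖ ≤ r′`, then there is a
`p`-th root of unity `ζ` with `‖h′ - ζ w‖ ≤ p r′`. -/
theorem exists_pth_root_of_unity_close_linear
    {K : Type*} [NormedField K] [IsAlgClosed K] [CompleteSpace K] [IsUltrametricDist K]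
    (p : ℕ) (hp : p.Prime) (hpK : ‖(p : K)‖ = (p : ℝ)⁻¹)
    (h h' w : K) (hh : ‖h‖ = 1) (hw : w ^ p = h)
    (r' : ℝ) (hr0 : 0 < r') (hr1 : r' ≤ (p : ℝ) ^ (-(p : ℝ) / ((p : ℝ) - 1)))
    (hclose : ‖h' ^ p - h‖ ≤ r') :
    ∃ ζ : K, ζ ^ p = 1 ∧ ‖h' - ζ * w‖ ≤ (p : ℝ) * r' := by
  have hp0 : p ≠ 0 := hp.ne_zero
  have hm : (Polynomial.X ^ p - Polynomial.C h).Monic := Polynomial.monic_X_pow_sub_C h hp0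
  have mem_roots (a : K) : a ∈ (Polynomial.X ^ p - Polynomial.C h).roots ↔ a ^ p = h := by
    simp [Polynomial.mem_roots hm.ne_zero, sub_eq_zero]
  have hw_mem := (mem_roots w).2 hw
  have hroots : (Polynomial.X ^ p - Polynomial.C h).roots ≠ 0 := fun h0 => by
    simp [h0] at hw_mem
  obtain ⟨a, ha, hle⟩ :=
    (IsAlgClosed.splits _).exists_root_norm_sub_mul_norm_derivative_le hm hroots h'
  rw [mem_roots] at ha
  have norm_root {b : K} (hb : b ^ p = h) : ‖b‖ = 1 := by
    rw [← pow_eq_one_iff_of_nonneg (norm_nonneg b) hp0, ← norm_pow, hb, hh]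
  have hw0 : w ≠ 0 := norm_ne_zero_iff.1 (by simp [norm_root hw])
  refine ⟨a / w, by rw [div_pow, ha, hw, div_self (hw ▸ pow_ne_zero p hw0)], ?_⟩
  rw [div_mul_cancel₀ _ hw0]
  have hp_pos : (0 : ℝ) < p := by exact_mod_cast hp.pos
  have hder : ‖h' - a‖ / p ≤ ‖h' ^ p - h‖ := by
    simpa [Polynomial.derivative_X_pow, hpK, norm_root ha, div_eq_mul_inv] using hle
  exact (div_le_iff₀' hp_pos).1 (hder.trans hclose)
end

section
/- Let h, w ∈ K with ‖h‖ = 1 and w^p = h, and let r′ be a real number with 0 < r′ ≤ p^(−p/(p−1)). Then the set {z ∈ K : ‖z^p − h‖ ≤ r′} equals the union, over all ζ ∈ K with ζ^p = 1, of the closed balls B̄(ζ·w, p·r′). Moreover, if r′ < p^(−p/(p−1)), then these p closed balls are pairwise disjoint. -/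
/-- In an ultrametric field, no `n`-th root of unity is farther from `1` than a primitive one. -/
lemma norm_one_sub_le_of_isPrimitiveRoot {K : Type*} [NormedField K] [IsUltrametricDist K]
    {n : ℕ} [NeZero n] {ζ ξ : K} (hζ : IsPrimitiveRoot ζ n) (hξ : ξ ^ n = 1) :
    ‖1 - ξ‖ ≤ ‖1 - ζ‖ := by
  obtain ⟨i, -, rfl⟩ := hζ.eq_pow_of_pow_eq_one hξ
  rw [← geom_sum_mul_neg, norm_mul]
  refine mul_le_of_le_one_left (norm_nonneg _) ?_
  refine IsUltrametricDist.norm_sum_le_of_forall_le_of_nonneg zero_le_one fun j _ ↦ ?_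
  have hnorm : ‖ζ‖ = 1 := (pow_eq_one_iff_of_nonneg (norm_nonneg ζ) (NeZero.ne n)).1
    (by rw [← norm_pow, hζ.pow_eq_one, norm_one])
  rw [norm_pow, hnorm, one_pow]

/-- In an ultrametric field, `‖1 - ζ‖ ^ (p - 1) = ‖p‖` for a primitive `p`-th root of unity. -/
lemma norm_one_sub_pow_of_isPrimitiveRoot {K : Type*} [NormedField K] [IsUltrametricDist K]
    {p : ℕ} [hp : Fact p.Prime] {ζ : K} (hζ : IsPrimitiveRoot ζ p) :
    ‖1 - ζ‖ ^ (p - 1) = ‖(p : K)‖ := by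
  have : NeZero p := ⟨hp.out.ne_zero⟩
  rw [← Polynomial.eval_one_cyclotomic_prime (R := K) (p := p),
    Polynomial.cyclotomic_eq_prod_X_sub_primitiveRoots hζ, Polynomial.eval_prod, norm_prod,
    ← Nat.totient_prime hp.out, ← hζ.card_primitiveRoots]
  refine (Finset.prod_eq_pow_card fun ξ hξ ↦ ?_).symm
  have hξ' := (mem_primitiveRoots hp.out.pos).1 hξ
  simpa using le_antisymm (norm_one_sub_le_of_isPrimitiveRoot hζ hξ'.pow_eq_one)
    (norm_one_sub_le_of_isPrimitiveRoot hξ' hζ.pow_eq_one)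

/-- Distinct `p`-th roots of unity satisfy `‖ζ - ξ‖ ^ (p - 1) = ‖p‖`. -/
lemma norm_sub_pow_of_pow_eq_one {K : Type*} [NormedField K] [IsUltrametricDist K]
    {p : ℕ} [hp : Fact p.Prime] {ζ ξ : K} (hζ : ζ ^ p = 1) (hξ : ξ ^ p = 1) (hne : ζ ≠ ξ) :
    ‖ζ - ξ‖ ^ (p - 1) = ‖(p : K)‖ := by
  have hnorm : ‖ζ‖ = 1 := (pow_eq_one_iff_of_nonneg (norm_nonneg ζ) hp.out.ne_zero).1
    (by rw [← norm_pow, hζ, norm_one])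
  have hζ0 : ζ ≠ 0 := norm_ne_zero_iff.1 (by simp [hnorm])
  have hprim : IsPrimitiveRoot (ξ / ζ) p := by
    refine IsPrimitiveRoot.iff_orderOf.2 (orderOf_eq_prime ?_ ?_)
    · rw [div_pow, hζ, hξ, div_one]
    · rw [Ne, div_eq_one_iff_eq hζ0]
      exact hne.symm
  rw [← norm_one_sub_pow_of_isPrimitiveRoot hprim]
  congr 1
  rw [one_sub_div hζ0, norm_div, hnorm, div_one]

/-- With `K` algebraically closed, complete, nonarchimedean, `‖p‖ = p⁻¹`:
if `‖h‖ = 1`, `w^p = h` and `0 < r′ ≤ p^(-p/(p-1))`, then `{z : ‖z^p - h‖ ≤ r′}` is the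
union over `p`-th roots of unity `ζ` of the closed balls `B̄(ζ w, p r′)`; moreover if
`r′ < p^(-p/(p-1))` these `p` balls are pairwise disjoint. -/
theorem fiber_of_small_ball_under_p_power_map
    {K : Type*} [NormedField K] [IsAlgClosed K] [CompleteSpace K] [IsUltrametricDist K]
    (p : ℕ) (hp : p.Prime) (hpK : ‖(p : K)‖ = (p : ℝ)⁻¹)
    (h w : K) (hh : ‖h‖ = 1) (hw : w ^ p = h)
    (r' : ℝ) (hr0 : 0 < r') (hr1 : r' ≤ (p : ℝ) ^ (-(p : ℝ) / ((p : ℝ) - 1))) :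
    ({z : K | ‖z ^ p - h‖ ≤ r'} =
      ⋃ ζ ∈ {ζ : K | ζ ^ p = 1}, Metric.closedBall (ζ * w) ((p : ℝ) * r')) ∧
    (r' < (p : ℝ) ^ (-(p : ℝ) / ((p : ℝ) - 1)) →
      ∀ ζ ζ' : K, ζ ^ p = 1 → ζ' ^ p = 1 → ζ ≠ ζ' →
        Disjoint (Metric.closedBall (ζ * w) ((p : ℝ) * r'))
          (Metric.closedBall (ζ' * w) ((p : ℝ) * r'))) := by
  classical
  have : Fact p.Prime := ⟨hp⟩
  have hp0 : (0 : ℝ) < p := by exact_mod_cast hp.pos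
  have hp1 : (1 : ℝ) < p := by exact_mod_cast hp.one_lt
  have hpsub : (p : ℝ) - 1 ≠ 0 := by linarith
  have : NeZero (p : K) := ⟨norm_ne_zero_iff.1 (by rw [hpK]; positivity)⟩
  obtain ⟨ω, hω⟩ := HasEnoughRootsOfUnity.exists_primitiveRoot K p
  have hw1 : ‖w‖ = 1 :=
    (pow_eq_one_iff_of_nonneg (norm_nonneg w) hp.ne_zero).1 (by rw [← norm_pow, hw, hh])
  -- `t` is the common distance between distinct `p`-th roots of `h`.
  obtain ⟨t, ht⟩ : ∃ t : ℝ, t = (p : ℝ) ^ (-1 / ((p : ℝ) - 1)) := ⟨_, rfl⟩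
  have ht0 : 0 < t := ht ▸ Real.rpow_pos_of_pos hp0 _
  have htp : t ^ (p - 1) = (p : ℝ)⁻¹ := by
    rw [ht, ← Real.rpow_natCast, ← Real.rpow_mul hp0.le, Nat.cast_pred hp.pos,
      div_mul_cancel₀ _ hpsub, Real.rpow_neg_one]
  have hbound : (p : ℝ) * (p : ℝ) ^ (-(p : ℝ) / ((p : ℝ) - 1)) = t := by
    rw [ht, ← Real.rpow_one_add' hp0.le]
    · congr 1
      field_simp
      ring
    · rw [one_add_div hpsub]
      exact div_ne_zero (by linarith) hpsub
  have hrt : p * r' ≤ t := hbound ▸ mul_le_mul_of_nonneg_left hr1 hp0.le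
  have hdist : ∀ ζ ξ : K, ζ ^ p = 1 → ξ ^ p = 1 → ζ ≠ ξ → ‖ζ * w - ξ * w‖ = t := by
    intro ζ ξ hζ hξ hne
    rw [← sub_mul, norm_mul, hw1, mul_one]
    refine (pow_left_inj₀ (norm_nonneg _) ht0.le (Nat.sub_ne_zero_of_lt hp.one_lt)).1 ?_
    rw [norm_sub_pow_of_pow_eq_one hζ hξ hne, hpK, htp]
  have hmem {ζ : K} : ζ ∈ Polynomial.nthRootsFinset p (1 : K) ↔ ζ ^ p = 1 :=
    Polynomial.mem_nthRootsFinset hp.pos 1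
  have hprod (z : K) {ζ : K} (hζ : ζ ^ p = 1) : ‖z ^ p - h‖ =
      ‖z - ζ * w‖ * ∏ ξ ∈ (Polynomial.nthRootsFinset p (1 : K)).erase ζ, ‖z - ξ * w‖ := by
    rw [← hw, hω.pow_sub_pow_eq_prod_sub_mul z w hp.pos, norm_prod,
      Finset.mul_prod_erase _ (fun ξ ↦ ‖z - ξ * w‖) (hmem.2 hζ)]
  have hconst {ζ : K} (hζ : ζ ^ p = 1) :
      ∏ _ξ ∈ (Polynomial.nthRootsFinset p (1 : K)).erase ζ, t = (p : ℝ)⁻¹ := by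
    rw [Finset.prod_const, Finset.card_erase_of_mem (hmem.2 hζ), hω.card_nthRootsFinset, htp]
  refine ⟨?_, ?_⟩
  · ext z
    simp only [Set.mem_ofPred_eq, Set.mem_iUnion, mem_closedBall_iff_norm, exists_prop]
    constructor
    · intro hz
      obtain ⟨ζ, hζ, hmin⟩ := Finset.exists_min_image (Polynomial.nthRootsFinset p (1 : K))
        (fun ξ ↦ ‖z - ξ * w‖) ⟨1, hmem.2 (one_pow p)⟩
      rw [hmem] at hζ
      refine ⟨ζ, hζ, ?_⟩
      rw [hprod z hζ] at hz
      have hle : (p : ℝ)⁻¹ ≤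
          ∏ ξ ∈ (Polynomial.nthRootsFinset p (1 : K)).erase ζ, ‖z - ξ * w‖ := by
        rw [← hconst hζ]
        refine Finset.prod_le_prod (fun _ _ ↦ ht0.le) fun ξ hξ ↦ ?_
        obtain ⟨hne, hξ⟩ := Finset.mem_erase.1 hξ
        rw [← hdist ζ ξ hζ (hmem.1 hξ) hne.symm, ← dist_eq_norm]
        refine (dist_triangle_max _ z _).trans (max_le ?_ (dist_eq_norm z _).le)
        rw [dist_comm, dist_eq_norm]
        exact hmin ξ hξ
      have := (mul_le_mul_of_nonneg_left hle (norm_nonneg (z - ζ * w))).trans hz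
      rwa [← div_eq_mul_inv, div_le_iff₀' hp0] at this
    · rintro ⟨ζ, hζ, hz⟩
      rw [hprod z hζ]
      have hle : ∏ ξ ∈ (Polynomial.nthRootsFinset p (1 : K)).erase ζ, ‖z - ξ * w‖ ≤
          (p : ℝ)⁻¹ := by
        rw [← hconst hζ]
        refine Finset.prod_le_prod (fun _ _ ↦ norm_nonneg _) fun ξ hξ ↦ ?_
        obtain ⟨hne, hξ⟩ := Finset.mem_erase.1 hξ
        rw [← dist_eq_norm]
        refine (dist_triangle_max _ (ζ * w) _).trans (max_le ?_ ?_)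
        · rw [dist_eq_norm]
          exact hz.trans hrt
        · rw [dist_eq_norm]
          exact (hdist ζ ξ hζ (hmem.1 hξ) hne.symm).le
      refine (mul_le_mul_of_nonneg_left hle (norm_nonneg _)).trans ?_
      rwa [← div_eq_mul_inv, div_le_iff₀' hp0]
  · intro hlt ζ ξ hζ hξ hne
    have hrt' : p * r' < t := hbound ▸ mul_lt_mul_of_pos_left hlt hp0
    refine Set.disjoint_left.2 fun z hz hz' ↦ hrt'.not_ge ?_
    rw [← hdist ζ ξ hζ hξ hne, ← dist_eq_norm]
    exact (dist_triangle_max _ z _).trans (max_le (Metric.mem_closedBall'.1 hz) hz')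
end

section
/- Let h, w ∈ K with ‖h‖ = 1 and w^p = h, and let r′ be a real number with p^(−p/(p−1)) ≤ r′ < 1. Then the set {z ∈ K : ‖z^p − h‖ ≤ r′} equals the single closed ball B̄(w, r′^(1/p)); in particular this ball contains all elements ζ·w with ζ^p = 1. -/
/-- In an ultrametric field, the mixed terms of `(x + y) ^ p` have norm at most `‖p‖ * ‖y‖` on
the unit ball. -/
lemma norm_add_pow_prime_sub_le {K : Type*} [NormedField K] [IsUltrametricDist K]
    {p : ℕ} (hp : p.Prime) {x y : K} (hx : ‖x‖ ≤ 1) (hy : ‖y‖ ≤ 1) :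
    ‖(x + y) ^ p - x ^ p - y ^ p‖ ≤ ‖(p : K)‖ * ‖y‖ := by
  let O := (NormedField.valuation (K := K)).integer
  obtain ⟨r, hr⟩ := exists_add_pow_prime_eq hp (⟨x, hx⟩ : O) ⟨y, hy⟩
  have hr' : (x + y) ^ p = x ^ p + y ^ p + p * x * y * r := congrArg (Subtype.val) hr
  have hr1 : ‖(r : K)‖ ≤ 1 := r.2
  have hxr : ‖x‖ * ‖(r : K)‖ ≤ 1 := mul_le_one₀ hx (norm_nonneg _) hr1
  calc ‖(x + y) ^ p - x ^ p - y ^ p‖ = ‖(p : K)‖ * ‖y‖ * (‖x‖ * ‖(r : K)‖) := by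
        rw [hr', show x ^ p + y ^ p + p * x * y * r - x ^ p - y ^ p = p * y * (x * r) by ring]
        simp only [norm_mul]
    _ ≤ ‖(p : K)‖ * ‖y‖ := mul_le_of_le_one_right (by positivity) hxr


/-- With `K` algebraically closed, complete, nonarchimedean, `‖p‖ = p⁻¹`:
if `‖h‖ = 1`, `w^p = h` and `p^(-p/(p-1)) ≤ r′ < 1`, then `{z : ‖z^p - h‖ ≤ r′}` is the
single closed ball `B̄(w, r′^(1/p))`; in particular this ball contains every `ζ w` with
`ζ^p = 1`. -/
theorem fiber_of_large_ball_under_p_power_map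
    {K : Type*} [NormedField K] [IsAlgClosed K] [CompleteSpace K] [IsUltrametricDist K]
    (p : ℕ) (hp : p.Prime) (hpK : ‖(p : K)‖ = (p : ℝ)⁻¹)
    (h w : K) (hh : ‖h‖ = 1) (hw : w ^ p = h)
    (r' : ℝ) (hr0 : (p : ℝ) ^ (-(p : ℝ) / ((p : ℝ) - 1)) ≤ r') (hr1 : r' < 1) :
    ({z : K | ‖z ^ p - h‖ ≤ r'} = Metric.closedBall w (r' ^ ((1 : ℝ) / p))) ∧
    (∀ ζ : K, ζ ^ p = 1 → ζ * w ∈ Metric.closedBall w (r' ^ ((1 : ℝ) / p))) := by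
  have hp0 : (0 : ℝ) < p := by exact_mod_cast hp.pos
  have hp1 : (0 : ℝ) < (p : ℝ) - 1 := by
    have : (1 : ℝ) < p := by exact_mod_cast hp.one_lt
    linarith
  have hr' : 0 < r' := (Real.rpow_pos_of_pos hp0 _).trans_le hr0
  set s : ℝ := r' ^ ((1 : ℝ) / p) with hs
  have hs0 : 0 < s := Real.rpow_pos_of_pos hr' _
  have hsp : s ^ p = r' := by
    rw [hs, one_div, Real.rpow_inv_natCast_pow hr'.le hp.ne_zero]
  have hs1 : s < 1 := Real.rpow_lt_one hr'.le hr1 (by positivity)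
  have hsub : (p : ℝ)⁻¹ ≤ s ^ (p - 1) := by
    have h1 : ((p : ℝ) ^ (-(p : ℝ) / ((p : ℝ) - 1))) ^ (((p : ℝ) - 1) / p) = (p : ℝ)⁻¹ := by
      rw [← Real.rpow_mul hp0.le, ← Real.rpow_neg_one]
      congr 1
      field_simp
    have h2 : s ^ (p - 1) = r' ^ (((p : ℝ) - 1) / p) := by
      rw [hs, ← Real.rpow_natCast, ← Real.rpow_mul hr'.le, Nat.cast_sub hp.one_le]
      congr 1
      push_cast
      ring
    rw [h2, ← h1]
    exact Real.rpow_le_rpow (by positivity) hr0 (by positivity)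
  have hpow (t : ℝ) : t ^ p = t ^ (p - 1) * t := by
    rw [← pow_succ, Nat.sub_add_cancel hp.one_le]
  have hw1 : ‖w‖ = 1 := by
    rw [← hw, norm_pow] at hh
    exact (pow_eq_one_iff_of_nonneg (norm_nonneg _) hp.ne_zero).1 hh
  have hsubmax (a b : K) : ‖a - b‖ ≤ max ‖a‖ ‖b‖ := by
    simpa [sub_eq_add_neg] using IsUltrametricDist.norm_add_le_max a (-b)
  have key : {z : K | ‖z ^ p - h‖ ≤ r'} = Metric.closedBall w s := by
    ext z
    rw [Set.mem_ofPred_eq, mem_closedBall_iff_norm]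
    have hmixed (hu : ‖z - w‖ ≤ 1) :
        ‖z ^ p - h - (z - w) ^ p‖ ≤ (p : ℝ)⁻¹ * ‖z - w‖ := by
      simpa [hw, hpK] using norm_add_pow_prime_sub_le hp hw1.le hu
    constructor
    · intro hz
      have hz1 : ‖z‖ ≤ 1 := by
        rw [← pow_le_one_iff_of_nonneg (norm_nonneg _) hp.ne_zero, ← norm_pow,
          ← sub_add_cancel (z ^ p) h]
        exact (IsUltrametricDist.norm_add_le_max _ _).trans (max_le (hz.trans hr1.le) hh.le)
      have hu : ‖z - w‖ ≤ 1 :=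
        (hsubmax _ _).trans (max_le hz1 hw1.le)
      by_contra! hlt
      have hlt1 : (p : ℝ)⁻¹ * ‖z - w‖ < ‖z - w‖ ^ p := by
        rw [hpow]
        refine mul_lt_mul_of_pos_right (hsub.trans_lt ?_) (hs0.trans hlt)
        exact pow_lt_pow_left₀ hlt hs0.le (Nat.sub_ne_zero_of_lt hp.one_lt)
      have hlt2 : r' < ‖z - w‖ ^ p := hsp ▸ pow_lt_pow_left₀ hlt hs0.le hp.ne_zero
      have hle : ‖z - w‖ ^ p ≤ max ‖z ^ p - h‖ ‖z ^ p - h - (z - w) ^ p‖ := by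
        rw [← norm_pow]
        simpa only [sub_sub_cancel] using hsubmax (z ^ p - h) (z ^ p - h - (z - w) ^ p)
      exact hle.not_gt (max_lt (hz.trans_lt hlt2) ((hmixed hu).trans_lt hlt1))
    · intro hz
      rw [← sub_add_cancel (z ^ p - h) ((z - w) ^ p)]
      refine (IsUltrametricDist.norm_add_le_max _ _).trans (max_le ?_ ?_)
      · refine (hmixed (hz.trans hs1.le)).trans ?_
        rw [← hsp, hpow]
        gcongr
      · rw [norm_pow, ← hsp]
        gcongr
  refine ⟨key, fun ζ hζ => ?_⟩
  rw [← key, Set.mem_ofPred_eq, mul_pow, hζ, one_mul, hw, sub_self, norm_zero]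
  exact hr'.le
end

section
/- Let 𝔾 = (V, E, s, t, e ↦ ē) be a finite graph in which every vertex has valency at least 3, i.e. for every v ∈ V the set {e ∈ E : s(e) = v} has at least 3 elements. Let f : E → ℝ satisfy f(ē) = f(e) for all e ∈ E. Suppose that for every finite graph 𝔾′ = (V′, E′, s′, t′, e ↦ ē), every covering π : 𝔾′ → 𝔾, and every loop (e′_1, …, e′_n) of 𝔾′, one has Σ_{i=1}^{n} f(π(e′_i)) = 0. Then f(e) = 0 for every e ∈ E. -/
/-- A finite graph in Serre's sense: finite sets of vertices and edges, source and target
maps, and a fixed-point-free involution `bar` on edges exchanging source and target. -/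
structure SerreGraph where
  V : Type
  E : Type
  [fintypeV : Fintype V]
  [fintypeE : Fintype E]
  s : E → V
  t : E → V
  bar : E → E
  bar_bar : ∀ e, bar (bar e) = e
  bar_ne : ∀ e, bar e ≠ e
  s_bar : ∀ e, s (bar e) = t e
  t_bar : ∀ e, t (bar e) = s e

attribute [instance] SerreGraph.fintypeV SerreGraph.fintypeE

/-- A covering of graphs: maps on vertices and edges commuting with sources, targets
and the involutions, which are bijective on the star of every vertex. -/
structure GraphCovering (G' G : SerreGraph) where
  vmap : G'.V → G.V
  emap : G'.E → G.E
  s_comm : ∀ e, G.s (emap e) = vmap (G'.s e)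
  t_comm : ∀ e, G.t (emap e) = vmap (G'.t e)
  bar_comm : ∀ e, G.bar (emap e) = emap (G'.bar e)
  star_bij : ∀ v' : G'.V,
    Set.BijOn emap {e : G'.E | G'.s e = v'} {e : G.E | G.s e = vmap v'}

/-- A loop of a graph: a cyclic sequence of `n ≥ 1` edges, consecutive (cyclically),
passing through pairwise distinct vertices and pairwise distinct geometric edges. -/
def SerreGraph.IsLoop (G : SerreGraph) (n : ℕ) (e : ℕ → G.E) : Prop :=
  0 < n ∧
  (∀ i < n, G.t (e i) = G.s (e ((i + 1) % n))) ∧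
  (∀ i < n, ∀ j < n, i ≠ j → G.s (e i) ≠ G.s (e j)) ∧
  (∀ i < n, ∀ j < n, i ≠ j → e i ≠ e j ∧ e i ≠ G.bar (e j))

namespace SerreGraph

/-- The covering of `G` with fibre `S` whose monodromy along the edge `e` is `φ e`. -/
def permCover (G : SerreGraph) (S : Type) [Fintype S] (φ : G.E → Equiv.Perm S)
    (hφ : ∀ e, φ (G.bar e) = (φ e)⁻¹) : SerreGraph where
  V := G.V × S
  E := G.E × S
  s p := (G.s p.1, p.2)
  t p := (G.t p.1, φ p.1 p.2)
  bar p := (G.bar p.1, φ p.1 p.2)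
  bar_bar p := by simp [G.bar_bar, hφ]
  bar_ne p h := G.bar_ne p.1 (congrArg Prod.fst h)
  s_bar p := by simp [G.s_bar]
  t_bar p := by simp [G.t_bar, hφ]

/-- The projection of `permCover` onto the base graph. -/
def permCoverProj (G : SerreGraph) (S : Type) [Fintype S] (φ : G.E → Equiv.Perm S)
    (hφ : ∀ e, φ (G.bar e) = (φ e)⁻¹) : GraphCovering (G.permCover S φ hφ) G where
  vmap := Prod.fst
  emap := Prod.fst
  s_comm _ := rfl
  t_comm _ := rfl
  bar_comm _ := rfl
  star_bij := by
    rintro ⟨v, x⟩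
    refine ⟨?_, ?_, ?_⟩
    · rintro ⟨e, y⟩ h
      exact congrArg Prod.fst h
    · rintro ⟨e, y⟩ h ⟨e', y'⟩ h' hee
      exact Prod.ext hee ((congrArg Prod.snd h).trans (congrArg Prod.snd h').symm)
    · intro e h
      exact ⟨(e, x), Prod.ext h rfl, rfl⟩

/-- A partial injection of a finite type, given by its graph, extends to a permutation. -/
theorem exists_perm_of_partial_injection {S : Type*} [Fintype S] (R : S → S → Prop)
    (h₁ : ∀ i j k, R i j → R i k → j = k) (h₂ : ∀ i j k, R i k → R j k → i = j) :
    ∃ P : Equiv.Perm S, ∀ i j, R i j → P i = j := by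
  classical
  let g : S → S := fun i => if h : ∃ j, R i j then h.choose else i
  have hg : ∀ i, (∃ j, R i j) → R i (g i) := fun i h => by
    simpa only [g, dif_pos h] using h.choose_spec
  obtain ⟨P, hP⟩ := Finset.exists_equiv_extend_of_card_eq (α := S) (t := Finset.univ)
    (s := Finset.univ.filter fun i => ∃ j, R i j) (f := g)
    Finset.card_univ.symm (Finset.subset_univ _) (by
      intro i hi j hj hij
      have hi' := hg i (by simpa using hi)
      have hj' := hg j (by simpa using hj)
      exact h₂ i j _ hi' (hij ▸ hj'))
  refine ⟨P.trans (Equiv.subtypeUnivEquiv Finset.mem_univ), fun i j hij => ?_⟩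
  have := hP i (by simpa using ⟨j, hij⟩)
  exact this.trans (h₁ i _ _ (hg i ⟨j, hij⟩) hij)

/-- A family of non-backtracking closed walks, given by a permutation `ρ` of the index type,
is lifted to a family of pairwise disjoint loops by some monodromy. -/
theorem exists_monodromy (G : SerreGraph) {S : Type} [Fintype S] (ρ : Equiv.Perm S)
    (u : S → G.E) (hu : ∀ i, u (ρ i) ≠ G.bar (u i)) :
    ∃ φ : G.E → Equiv.Perm S, (∀ e, φ (G.bar e) = (φ e)⁻¹) ∧ ∀ i, φ (u i) i = ρ i := by
  classical
  have key : ∀ e, ∃ P : Equiv.Perm S,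
      ∀ i j, ((u i = e ∧ j = ρ i) ∨ (u j = G.bar e ∧ i = ρ j)) → P i = j := by
    intro e
    apply exists_perm_of_partial_injection
    · rintro i j k (⟨h, rfl⟩ | ⟨h, rfl⟩) (⟨h', rfl⟩ | ⟨h', h''⟩)
      · rfl
      · exact absurd (by rw [← h'', h, h', G.bar_bar]) (hu k)
      · exact absurd (by rw [h, h', G.bar_bar]) (hu j)
      · exact ρ.injective h''
    · rintro i j k (⟨h, rfl⟩ | ⟨h, rfl⟩) (⟨h', h''⟩ | ⟨h', rfl⟩)
      · exact ρ.injective h''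
      · exact absurd (by rw [h, h']) (hu i)
      · subst h''
        exact absurd (by rw [h, h']) (hu j)
      · rfl
  choose P hP using key
  let o := Fintype.equivFin G.E
  refine ⟨fun e => if o e < o (G.bar e) then P e else (P (G.bar e))⁻¹, fun e => ?_, fun i => ?_⟩
  · have hne : o e ≠ o (G.bar e) := fun h => G.bar_ne e (o.injective h).symm
    rcases lt_or_gt_of_ne hne with h | h
    · simp [G.bar_bar, h, h.not_gt]
    · simp [G.bar_bar, h, h.not_gt]
  · dsimp only
    split_ifs
    · exact hP _ _ _ (Or.inl ⟨rfl, rfl⟩)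
    · rw [Equiv.Perm.inv_eq_iff_eq]
      exact (hP _ _ _ (Or.inr ⟨(G.bar_bar _).symm, rfl⟩)).symm

end SerreGraph

/-- If the sums of `g` over all cycles of a permutation vanish, so does the total sum. -/
theorem sum_eq_zero_of_sum_cycle_eq_zero {S : Type*} [Fintype S] (ρ : Equiv.Perm S) (g : S → ℝ)
    (h : ∀ x, ∑ i ∈ Finset.range (Function.minimalPeriod ρ x), g ((ρ ^ i) x) = 0) :
    ∑ x, g x = 0 := by
  have hmul : ∀ x k, ∑ i ∈ Finset.range (Function.minimalPeriod ρ x * k), g ((ρ ^ i) x) = 0 := by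
    intro x k
    induction k with
    | zero => simp
    | succ k ih =>
      rw [Nat.mul_succ, Finset.sum_range_add, ih, zero_add, ← h x]
      refine Finset.sum_congr rfl fun i _ => ?_
      have hp : (ρ ^ (Function.minimalPeriod ρ x * k)) x = x := by
        have := (Function.isPeriodicPt_minimalPeriod ρ x).mul_const k
        rwa [Function.IsPeriodicPt, Function.IsFixedPt, ← Equiv.Perm.coe_pow] at this
      rw [add_comm, pow_add, Equiv.Perm.mul_apply, hp]
  have hN : ∀ x, ∑ i ∈ Finset.range (orderOf ρ), g ((ρ ^ i) x) = 0 := by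
    intro x
    obtain ⟨k, hk⟩ : Function.minimalPeriod ρ x ∣ orderOf ρ := by
      apply Function.IsPeriodicPt.minimalPeriod_dvd
      rw [Function.IsPeriodicPt, Function.IsFixedPt, ← Equiv.Perm.coe_pow, pow_orderOf_eq_one]
      rfl
    rw [hk, hmul]
  have hsum : (orderOf ρ : ℝ) * ∑ x, g x = 0 := by
    calc (orderOf ρ : ℝ) * ∑ x, g x = ∑ i ∈ Finset.range (orderOf ρ), ∑ x, g ((ρ ^ i) x) := by
          simp [Equiv.sum_comp]
      _ = 0 := by
          rw [Finset.sum_comm]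
          exact Finset.sum_eq_zero fun x _ => hN x
  have := orderOf_pos ρ
  exact (mul_eq_zero.mp hsum).resolve_left (by positivity)

namespace SerreGraph

/-- Under the vanishing hypothesis, the total of `f` over any finite family of
non-backtracking closed walks is zero. -/
theorem sum_eq_zero_of_closed_walks (G : SerreGraph) (f : G.E → ℝ)
    (hloops : ∀ (G' : SerreGraph) (π : GraphCovering G' G) (n : ℕ) (e : ℕ → G'.E),
      G'.IsLoop n e → ∑ i ∈ Finset.range n, f (π.emap (e i)) = 0)
    {S : Type} [Fintype S] (ρ : Equiv.Perm S) (u : S → G.E)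
    (hst : ∀ i, G.s (u (ρ i)) = G.t (u i)) (hu : ∀ i, u (ρ i) ≠ G.bar (u i)) :
    ∑ i, f (u i) = 0 := by
  obtain ⟨φ, hφ, hφρ⟩ := G.exists_monodromy ρ u hu
  refine sum_eq_zero_of_sum_cycle_eq_zero ρ (fun i => f (u i)) fun x => ?_
  set n := Function.minimalPeriod ρ x with hn
  have hinj : ∀ i < n, ∀ j < n, i ≠ j → (ρ ^ i) x ≠ (ρ ^ j) x := by
    intro i hi j hj hij h
    apply hij
    rw [Equiv.Perm.coe_pow, Equiv.Perm.coe_pow] at h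
    exact (Function.iterate_eq_iterate_iff_of_lt_minimalPeriod hi hj).mp h
  have hmod : ∀ i, (ρ ^ (i % n)) x = (ρ ^ i) x := by
    intro i
    rw [Equiv.Perm.coe_pow, Equiv.Perm.coe_pow]
    exact Function.iterate_mod_minimalPeriod_eq
  refine hloops _ (G.permCoverProj S φ hφ) n (fun i => (u ((ρ ^ i) x), (ρ ^ i) x)) ⟨?_, ?_, ?_, ?_⟩
  · exact Function.minimalPeriod_pos_of_mem_periodicPts
      (Function.Injective.mem_periodicPts ρ.injective x)
  · intro i _
    refine Prod.ext ?_ ?_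
    · simp only [permCover]
      rw [hmod, pow_succ', Equiv.Perm.mul_apply, hst]
    · simp only [permCover]
      rw [hmod, pow_succ', Equiv.Perm.mul_apply, hφρ]
  · intro i hi j hj hij h
    exact hinj i hi j hj hij (congrArg Prod.snd h)
  · intro i hi j hj hij
    refine ⟨fun h => hinj i hi j hj hij (congrArg Prod.snd h), fun h => ?_⟩
    have h₁ : u ((ρ ^ i) x) = G.bar (u ((ρ ^ j) x)) := congrArg Prod.fst h
    have h₂ : (ρ ^ i) x = φ (u ((ρ ^ j) x)) ((ρ ^ j) x) := congrArg Prod.snd h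
    rw [hφρ] at h₂
    exact hu _ (h₂ ▸ h₁)

/-- A graph all of whose valencies are at least `2` has a permutation of its edges which
preserves sources and has no fixed point. -/
theorem exists_derangement (G : SerreGraph)
    (hval : ∀ v : G.V, 2 ≤ Set.ncard {e : G.E | G.s e = v}) :
    ∃ δ : Equiv.Perm G.E, (∀ e, G.s (δ e) = G.s e) ∧ ∀ e, δ e ≠ e := by
  classical
  have key : ∀ v, ∃ c : Equiv.Perm {e : G.E // G.s e = v}, ∀ x, c x ≠ x := by
    intro v
    have hc : 2 ≤ Fintype.card {e : G.E // G.s e = v} := by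
      rw [← Nat.card_eq_fintype_card]
      exact hval v
    obtain ⟨m, hm⟩ := Nat.exists_eq_add_of_le' hc
    let o : {e : G.E // G.s e = v} ≃ Fin (m + 2) := Fintype.equivFinOfCardEq hm
    refine ⟨(o.trans (finRotate (m + 2))).trans o.symm, fun x hx => ?_⟩
    have : finRotate (m + 2) (o x) = o x := by
      rwa [Equiv.trans_apply, Equiv.trans_apply, Equiv.symm_apply_eq] at hx
    simp at this
  choose c hc using key
  let F := Equiv.sigmaFiberEquiv G.s
  refine ⟨(F.symm.trans (Equiv.Perm.sigmaCongrRight c)).trans F, fun e => ?_, fun e => ?_⟩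
  · exact (c (G.s e) ⟨e, rfl⟩).2
  · intro h
    exact hc (G.s e) ⟨e, rfl⟩ (Subtype.ext h)

end SerreGraph

/-- Let `𝔾` be a finite graph in which every vertex has valency at
least `3`, and let `f` be a real-valued function on edges with `f(ē) = f(e)`. If for
every covering `𝔾′ → 𝔾` and every loop of `𝔾′` the sum of `f` over the (images of the)
edges of the loop vanishes, then `f = 0`. -/
theorem eq_zero_of_sum_over_loops_of_coverings_eq_zero
    (G : SerreGraph) (hval : ∀ v : G.V, 3 ≤ Set.ncard {e : G.E | G.s e = v})
    (f : G.E → ℝ) (hf : ∀ e, f (G.bar e) = f e)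
    (hloops : ∀ (G' : SerreGraph) (π : GraphCovering G' G) (n : ℕ) (e : ℕ → G'.E),
      G'.IsLoop n e → ∑ i ∈ Finset.range n, f (π.emap (e i)) = 0) :
    ∀ e : G.E, f e = 0 := by
  classical
  obtain ⟨δ, hδs, hδ⟩ := G.exists_derangement fun v => le_trans (by norm_num) (hval v)
  have hbase : ∑ x, f x = 0 := by
    refine G.sum_eq_zero_of_closed_walks f hloops
      ((Function.Involutive.toPerm G.bar G.bar_bar).trans δ) id (fun x => ?_) (fun x => ?_)
    · exact (hδs _).trans (G.s_bar x)
    · exact hδ _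
  have hex : ∀ d : G.E, ∃ c : G.E, G.s c = G.s d ∧ c ≠ d ∧ δ c ≠ d := by
    intro d
    have hlt : ({d, δ.symm d} : Set G.E).ncard < {e : G.E | G.s e = G.s d}.ncard :=
      (Set.ncard_insert_le _ _).trans_lt (by rw [Set.ncard_singleton]; exact hval (G.s d))
    obtain ⟨c, hc, hcd⟩ := Set.exists_mem_notMem_of_ncard_lt_ncard hlt
    refine ⟨c, hc, fun h => hcd (by simp [h]), fun h => hcd ?_⟩
    simp [← h]
  choose c hcs hcd hδc using hex
  intro e
  let d : Bool → G.E := fun i => if i then G.bar e else e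
  have hd : ∀ i, d (!i) = G.bar (d i) := by
    rintro (_ | _) <;> simp [d, G.bar_bar]
  -- Two copies of the base family; in copy `i` the passage from `bar (c (d i))` to `δ (c (d i))`
  -- is rerouted through an additional traversal of `d i`, and then to the other copy.
  let r : Option G.E × Bool → Option G.E × Bool := fun p =>
    match p with
    | (none, i) => (some (δ (c (d (!i)))), !i)
    | (some x, i) => if G.bar x = c (d i) then (none, i) else (some (δ (G.bar x)), i)
  have hbar : Function.Injective G.bar := Function.Involutive.injective G.bar_bar
  have hr : Function.Injective r := by
    rintro ⟨_ | x, i⟩ ⟨_ | y, j⟩ h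
    · simp only [r, Prod.mk.injEq] at h
      simpa using h.2
    · simp only [r] at h
      split_ifs at h with hy
      · simp at h
      · simp only [Prod.mk.injEq, Option.some.injEq, δ.injective.eq_iff] at h
        exact absurd (by rw [← h.1, h.2]) hy
    · simp only [r] at h
      split_ifs at h with hx
      · simp at h
      · simp only [Prod.mk.injEq, Option.some.injEq, δ.injective.eq_iff] at h
        exact absurd (by rw [h.1, h.2]) hx
    · simp only [r] at h
      split_ifs at h with hx hy hy
      · simp only [Prod.mk.injEq, true_and] at h
        subst h
        rw [hbar (hx.trans hy.symm)]
      · simp at h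
      · simp at h
      · simp only [Prod.mk.injEq, Option.some.injEq, δ.injective.eq_iff, hbar.eq_iff] at h
        rw [h.1, h.2]
  let u : Option G.E × Bool → G.E := fun p => p.1.getD (d p.2)
  have htotal : ∑ p, f (u p) = 0 := by
    refine G.sum_eq_zero_of_closed_walks f hloops
      (Equiv.ofBijective r (Finite.injective_iff_bijective.mp hr)) u ?_ ?_
    · rintro ⟨_ | x, i⟩
      · simp [r, u, hδs, hcs, hd, G.s_bar]
      · by_cases hx : G.bar x = c (d i)
        · simpa [r, u, hx] using (hcs (d i)).symm.trans (hx ▸ G.s_bar x)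
        · simp [r, u, hx, hδs, G.s_bar]
    · rintro ⟨_ | x, i⟩
      · simpa [r, u, hd] using hδc (G.bar (d i))
      · by_cases hx : G.bar x = c (d i)
        · simpa [r, u, hx] using (hcd (d i)).symm
        · simpa [r, u, hx] using hδ (G.bar x)
  simp only [u, Fintype.sum_prod_type, Fintype.sum_option, Fintype.sum_bool, Option.getD_none,
    Option.getD_some, Finset.sum_add_distrib, hbase, d, if_true, Bool.false_eq_true, if_false,
    hf] at htotal
  linarith
end
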